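/- arXiv:1603.05639 — 4 statements merged into one kernel-verified Lean document; each statement's English description precedes it below -/
import Mathlib

section
/- There exists a positive constant c1 such that for every connected d-regular Eulerian digraph G on n vertices, every starting vertex v, and every 1 ≤ k ≤ n, the simple random walk on G started at v satisfies E_v[T_k] ≤ c1·k², where T_k = inf{t ≥ 0 : #{X_0, X_1, …, X_t} = k} is the first time the walk has visited k distinct vertices. -/
open Finset

/-- The out-degree of a vertex in a digraph. -/
def dout {V : Type} [Fintype V] (E : V → V → Prop) [DecidableRel E] (x : V) : ℕ :=
  (Finset.univ.filter fun y => E x y).card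

/-- The in-degree of a vertex in a digraph. -/
def din {V : Type} [Fintype V] (E : V → V → Prop) [DecidableRel E] (x : V) : ℕ :=
  (Finset.univ.filter fun y => E y x).card

/-- The number of directed edges of a digraph. -/
def numEdges {V : Type} [Fintype V] (E : V → V → Prop) [DecidableRel E] : ℕ :=
  ∑ x, dout E x

/-- The transition matrix of the (non-lazy) simple random walk on a digraph. -/
noncomputable def srwP {V : Type} [Fintype V] [DecidableEq V] (E : V → V → Prop)
    [DecidableRel E] : Matrix V V ℝ :=
  fun v w => if E v w then 1 / (dout E v : ℝ) else 0

/-- The probability that a Markov chain with transition matrix `P` follows the trajectory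
`x 0, x 1, …, x t` (given that it starts at `x 0`). -/
noncomputable def pathWeight {V : Type} [Fintype V] (P : Matrix V V ℝ) {t : ℕ}
    (x : Fin (t + 1) → V) : ℝ :=
  ∏ i : Fin t, P (x i.castSucc) (x i.succ)

/-- `exploreSurv P v k t` is the probability, for the chain with transition matrix `P` started
at `v`, that fewer than `k` distinct vertices have been visited by time `t`; that is,
`P_v(T_k > t)` where `T_k` is the first time `k` distinct vertices have been visited. -/
noncomputable def exploreSurv {V : Type} [Fintype V] [DecidableEq V] (P : Matrix V V ℝ)
    (v : V) (k t : ℕ) : ℝ :=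
  ∑ x : Fin (t + 1) → V,
    if x 0 = v ∧ (Finset.univ.image x).card < k then pathWeight P x else 0

section Exploration

variable {V : Type} [Fintype V] [DecidableEq V]

/-- The probability that the chain started at `v`, having already visited the set `A`, has
visited fewer than `k` distinct vertices after `t` further steps. -/
noncomputable def surviveFrom (P : Matrix V V ℝ) (k t : ℕ) (A : Finset V) (v : V) : ℝ :=
  ∑ x : Fin (t + 1) → V,
    if x 0 = v ∧ (A ∪ Finset.univ.image x).card < k then pathWeight P x else 0

lemma exploreSurv_eq_surviveFrom (P : Matrix V V ℝ) (v : V) (k t : ℕ) :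
    exploreSurv P v k t = surviveFrom P k t ∅ v := by
  simp [exploreSurv, surviveFrom]

lemma surviveFrom_zero (P : Matrix V V ℝ) (k : ℕ) (A : Finset V) (v : V) :
    surviveFrom P k 0 A v = if (insert v A).card < k then 1 else 0 := by
  unfold surviveFrom
  rw [← (Equiv.funUnique (Fin 1) V).symm.sum_comp]
  rw [Finset.sum_eq_single v]
  · simp [pathWeight]
  · intro b _ hb
    simp [hb]
  · simp

lemma surviveFrom_succ (P : Matrix V V ℝ) (k t : ℕ) (A : Finset V) (v : V) :
    surviveFrom P k (t + 1) A v = ∑ y, P v y * surviveFrom P k t (insert v A) y := by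
  unfold surviveFrom
  rw [← (Fin.consEquiv (fun _ : Fin (t + 2) => V)).sum_comp, Fintype.sum_prod_type,
    Finset.sum_eq_single v]
  · simp only [Finset.mul_sum]
    rw [Finset.sum_comm]
    refine Finset.sum_congr rfl fun x _ => ?_
    rw [Finset.sum_eq_single (x 0)]
    · have himg : A ∪ Finset.univ.image (Fin.cons v x : Fin (t + 2) → V)
          = insert v A ∪ Finset.univ.image x := by
        ext z
        simp only [Finset.mem_union, Finset.mem_image, Finset.mem_univ, true_and,
          Fin.exists_fin_succ, Fin.cons_zero, Fin.cons_succ, Finset.mem_insert]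
        tauto
      have hw : pathWeight P (Fin.cons v x : Fin (t + 2) → V)
          = P v (x 0) * pathWeight P x := by
        unfold pathWeight
        rw [Fin.prod_univ_succ]
        rfl
      change (if (Fin.cons v x : Fin (t + 2) → V) 0 = v ∧
        (A ∪ Finset.univ.image (Fin.cons v x : Fin (t + 2) → V)).card < k then
          pathWeight P (Fin.cons v x : Fin (t + 2) → V) else 0) = _
      rw [himg, hw, Fin.cons_zero]
      simp
    · intro b _ hb
      simp [hb.symm]
    · simp
  · intro b _ hb
    simp [hb]
  · simp

lemma surviveFrom_eq_zero (P : Matrix V V ℝ) {k : ℕ} (t : ℕ) {A : Finset V} {v : V}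
    (h : k ≤ (insert v A).card) : surviveFrom P k t A v = 0 := by
  refine Finset.sum_eq_zero fun x _ => if_neg ?_
  rintro ⟨h0, h1⟩
  have : insert v A ⊆ A ∪ Finset.univ.image x := by
    refine Finset.insert_subset ?_ Finset.subset_union_left
    exact Finset.mem_union_right _ (Finset.mem_image.2 ⟨0, Finset.mem_univ _, h0⟩)
  have := Finset.card_le_card this
  omega

/-- A supersolution bounds the expected remaining exploration time. `B A x b` reads: `b` is an
admissible bound when `A` has been visited and the walk is at `x`. -/
lemma sum_surviveFrom_le {P : Matrix V V ℝ} (hP : ∀ x y, 0 ≤ P x y) {k : ℕ}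
    (B : Finset V → V → ℝ → Prop) (hB0 : ∀ A x b, B A x b → 0 ≤ b)
    (hB : ∀ A x b, B A x b → A.card < k →
      ∃ b' : V → ℝ, (∀ y, B (insert y A) y (b' y)) ∧ 1 + ∑ y, P x y * b' y ≤ b) :
    ∀ (T : ℕ) (A : Finset V) (x : V) (b : ℝ), B (insert x A) x b →
      ∑ t ∈ Finset.range T, surviveFrom P k t A x ≤ b := by
  intro T
  induction T with
  | zero =>
    intro A x b h
    simpa using hB0 _ _ _ h
  | succ T ih =>
    intro A x b h
    by_cases hk : (insert x A).card < k
    · obtain ⟨b', hb', hle⟩ := hB _ _ _ h hk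
      rw [Finset.sum_range_succ', surviveFrom_zero, if_pos hk]
      simp only [surviveFrom_succ]
      rw [Finset.sum_comm]
      simp only [← Finset.mul_sum]
      have : ∑ y, P x y * ∑ t ∈ Finset.range T, surviveFrom P k t (insert x A) y
          ≤ ∑ y, P x y * b' y :=
        Finset.sum_le_sum fun y _ => mul_le_mul_of_nonneg_left (ih _ _ _ (hb' y)) (hP x y)
      linarith
    · rw [Finset.sum_eq_zero fun t _ => surviveFrom_eq_zero P t (not_lt.1 hk)]
      exact hB0 _ _ _ h

end Exploration

section Laplacian

/-- The effective resistance (normalized commute time) read off a potential kernel. -/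
def kernelResistance {V : Type} (u : V → V → ℝ) (x y : V) : ℝ :=
  (u x x - u y x) - (u x y - u y y)

lemma kernelResistance_comm {V : Type} (u : V → V → ℝ) (x y : V) :
    kernelResistance u x y = kernelResistance u y x := by
  simp only [kernelResistance]
  ring

variable {V : Type} [Fintype V]

/-- The Laplacian `(I - P) f`. -/
def lap (P : Matrix V V ℝ) (f : V → ℝ) (x : V) : ℝ :=
  f x - ∑ y, P x y * f y

/-- The Dirichlet energy of `f` for a doubly stochastic matrix `P`. -/
noncomputable def energy (P : Matrix V V ℝ) (f : V → ℝ) : ℝ :=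
  (∑ x, ∑ y, P x y * (f x - f y) ^ 2) / 2

/-- Functions of zero energy are constant. -/
def EnergyDefinite (P : Matrix V V ℝ) : Prop :=
  ∀ f, energy P f = 0 → ∀ x y, f x = f y

lemma lap_sub (P : Matrix V V ℝ) (f g : V → ℝ) (x : V) :
    lap P (fun y => f y - g y) x = lap P f x - lap P g x := by
  simp only [lap, mul_sub, Finset.sum_sub_distrib]
  ring

lemma lap_sum (P : Matrix V V ℝ) {ι : Type} (s : Finset ι) (f : ι → V → ℝ) (x : V) :
    lap P (fun y => ∑ i ∈ s, f i y) x = ∑ i ∈ s, lap P (f i) x := by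
  simp only [lap, Finset.mul_sum, Finset.sum_sub_distrib]
  rw [Finset.sum_comm]

lemma sum_mul_lap_comm {P : Matrix V V ℝ} (hS : ∀ x y, P x y = P y x) (f g : V → ℝ) :
    ∑ x, f x * lap P g x = ∑ x, g x * lap P f x := by
  simp only [lap, mul_sub, Finset.sum_sub_distrib, Finset.mul_sum]
  congr 1
  · exact Finset.sum_congr rfl fun x _ => mul_comm _ _
  · rw [Finset.sum_comm]
    refine Finset.sum_congr rfl fun x _ => Finset.sum_congr rfl fun y _ => ?_
    rw [hS y x]
    ring

variable [DecidableEq V] {P : Matrix V V ℝ}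

lemma lap_const (hP : P ∈ doublyStochastic ℝ V) (c : ℝ) (x : V) :
    lap P (fun _ => c) x = 0 := by
  simp [lap, ← Finset.sum_mul, sum_row_of_mem_doublyStochastic hP]

lemma sum_lap (hP : P ∈ doublyStochastic ℝ V) (f : V → ℝ) : ∑ x, lap P f x = 0 := by
  simp only [lap, Finset.sum_sub_distrib]
  rw [Finset.sum_comm]
  simp [← Finset.sum_mul, sum_col_of_mem_doublyStochastic hP]

lemma energy_nonneg (hP : P ∈ doublyStochastic ℝ V) (f : V → ℝ) : 0 ≤ energy P f :=
  div_nonneg (Finset.sum_nonneg fun _ _ => Finset.sum_nonneg fun _ _ =>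
    mul_nonneg (nonneg_of_mem_doublyStochastic hP) (sq_nonneg _)) zero_le_two

lemma sum_mul_lap_self (hP : P ∈ doublyStochastic ℝ V) (f : V → ℝ) :
    ∑ x, f x * lap P f x = energy P f := by
  have h1 : ∑ x, ∑ y, P x y * f x ^ 2 = ∑ x, f x ^ 2 := by
    simp [← Finset.sum_mul, sum_row_of_mem_doublyStochastic hP]
  have h2 : ∑ x, ∑ y, P x y * f y ^ 2 = ∑ x, f x ^ 2 := by
    rw [Finset.sum_comm]
    simp [← Finset.sum_mul, sum_col_of_mem_doublyStochastic hP]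
  have h3 : ∑ x, ∑ y, P x y * (f x - f y) ^ 2
      = ∑ x, ∑ y, P x y * f x ^ 2 + ∑ x, ∑ y, P x y * f y ^ 2
        - 2 * ∑ x, f x * ∑ y, P x y * f y := by
    simp only [Finset.mul_sum, ← Finset.sum_add_distrib, ← Finset.sum_sub_distrib]
    refine Finset.sum_congr rfl fun x _ => Finset.sum_congr rfl fun y _ => ?_
    ring
  rw [energy, h3, h1, h2]
  simp only [lap, mul_sub, Finset.sum_sub_distrib, ← pow_two]
  ring

/-- The Poisson equation is solvable for every right-hand side of zero sum. -/
lemma exists_lap_eq (hP : P ∈ doublyStochastic ℝ V) (hE : EnergyDefinite P) (b : V → ℝ)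
    (hb : ∑ x, b x = 0) : ∃ u, ∀ x, lap P u x = b x := by
  rcases isEmpty_or_nonempty V with hV | hV
  · exact ⟨0, fun x => isEmptyElim x⟩
  have hn : (Fintype.card V : ℝ) ≠ 0 := by exact_mod_cast Fintype.card_ne_zero
  let T : (V → ℝ) →ₗ[ℝ] (V → ℝ) :=
    { toFun := fun f x => lap P f x + ∑ y, f y
      map_add' := fun f g => by
        ext x
        simp only [lap, Pi.add_apply, mul_add, Finset.sum_add_distrib]
        ring
      map_smul' := fun c f => by
        ext x
        simp only [lap, Pi.smul_apply, smul_eq_mul, RingHom.id_apply, mul_add, mul_sub,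
          Finset.mul_sum]
        congr 2
        exact Finset.sum_congr rfl fun y _ => by ring }
  have hT : ∀ f x, T f x = lap P f x + ∑ y, f y := fun _ _ => rfl
  have hsum : ∀ f, ∑ x, T f x = Fintype.card V * ∑ y, f y := fun f => by
    simp [hT, Finset.sum_add_distrib, sum_lap hP]
  have hinj : Function.Injective T := by
    rw [injective_iff_map_eq_zero]
    intro f hf
    have h0 : ∑ y, f y = 0 := by
      have := hsum f
      rw [hf] at this
      simpa [hn] using this.symm
    have hlap : ∀ x, lap P f x = 0 := fun x => by
      have := hT f x
      rw [hf, h0] at this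
      simpa using this.symm
    have hc := hE f (by simp [← sum_mul_lap_self hP, hlap])
    ext x
    have : ∑ y, f y = Fintype.card V * f x := by
      rw [Finset.sum_congr rfl fun y _ => hc y x]
      simp
    rw [h0] at this
    simpa [hn] using this.symm
  obtain ⟨u, hu⟩ := LinearMap.injective_iff_surjective.1 hinj b
  have h0 : ∑ y, u y = 0 := by
    have := hsum u
    rw [hu, hb] at this
    simpa [hn] using this.symm
  refine ⟨u, fun x => ?_⟩
  rw [← hu, hT, h0, add_zero]

/-- A function vanishing on a nonempty set and harmonic off it vanishes. -/
lemma eq_zero_of_harmonic_off (hP : P ∈ doublyStochastic ℝ V) (hE : EnergyDefinite P)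
    {Z : Finset V} (hZ : Z.Nonempty) {f : V → ℝ} (h0 : ∀ x ∈ Z, f x = 0)
    (h1 : ∀ x ∉ Z, lap P f x = 0) (x : V) : f x = 0 := by
  obtain ⟨z, hz⟩ := hZ
  have : energy P f = 0 := by
    rw [← sum_mul_lap_self hP]
    refine Finset.sum_eq_zero fun x _ => ?_
    by_cases hx : x ∈ Z
    · simp [h0 x hx]
    · simp [h1 x hx]
  rw [hE f this x z, h0 z hz]

/-- A function nonnegative on a nonempty set and harmonic off it is nonnegative. -/
lemma nonneg_of_harmonic_off (hP : P ∈ doublyStochastic ℝ V) (hE : EnergyDefinite P)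
    {Z : Finset V} (hZ : Z.Nonempty) {f : V → ℝ} (h0 : ∀ x ∈ Z, 0 ≤ f x)
    (h1 : ∀ x ∉ Z, lap P f x = 0) (x : V) : 0 ≤ f x := by
  obtain ⟨z, hz⟩ := hZ
  let g : V → ℝ := fun y => max (-f y) 0
  let p : V → ℝ := fun y => max (f y) 0
  have hg0 : ∀ y, 0 ≤ g y := fun y => le_max_right _ _
  have hp0 : ∀ y, 0 ≤ p y := fun y => le_max_right _ _
  have hf : ∀ y, f y = p y - g y := fun y => by
    rcases le_total 0 (f y) with h | h <;> simp [p, g, h]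
  have hpg : ∀ y, g y * p y = 0 := fun y => by
    rcases le_total 0 (f y) with h | h <;> simp [p, g, h]
  have hgZ : ∀ y ∈ Z, g y = 0 := fun y hy => by simp [g, h0 y hy]
  have hgf : ∑ y, g y * lap P f y = 0 := Finset.sum_eq_zero fun y _ => by
    by_cases hy : y ∈ Z
    · simp [hgZ y hy]
    · simp [h1 y hy]
  have hgp : ∑ y, g y * lap P p y ≤ 0 := Finset.sum_nonpos fun y _ => by
    rw [lap, mul_sub, hpg, zero_sub, neg_nonpos]
    exact mul_nonneg (hg0 y) (Finset.sum_nonneg fun w _ =>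
      mul_nonneg (nonneg_of_mem_doublyStochastic hP) (hp0 w))
  have hsub : ∑ y, g y * lap P f y = ∑ y, g y * lap P p y - energy P g := by
    rw [← sum_mul_lap_self hP, ← Finset.sum_sub_distrib]
    refine Finset.sum_congr rfl fun y _ => ?_
    rw [← mul_sub, ← lap_sub, ← funext hf]
  have : energy P g = 0 := le_antisymm (by linarith) (energy_nonneg hP g)
  have hgx : g x = 0 := by rw [hE g this x z, hgZ z hz]
  rw [hf x, hgx, sub_zero]
  exact hp0 x

/-- Solvability of the Dirichlet problem. -/
lemma exists_harmonic_off (hP : P ∈ doublyStochastic ℝ V) (hE : EnergyDefinite P)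
    {Z : Finset V} (hZ : Z.Nonempty) (b : V → ℝ) :
    ∃ f : V → ℝ, (∀ x ∈ Z, f x = b x) ∧ ∀ x ∉ Z, lap P f x = 0 := by
  let T : (V → ℝ) →ₗ[ℝ] (V → ℝ) :=
    { toFun := fun f x => if x ∈ Z then f x else lap P f x
      map_add' := fun f g => by
        ext x
        simp only [lap, Pi.add_apply, mul_add, Finset.sum_add_distrib]
        split_ifs <;> ring
      map_smul' := fun c f => by
        ext x
        simp only [lap, Pi.smul_apply, smul_eq_mul, RingHom.id_apply]
        split_ifs
        · rfl
        · rw [mul_sub, Finset.mul_sum]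
          congr 1
          exact Finset.sum_congr rfl fun y _ => by ring }
  have hT : ∀ f x, T f x = if x ∈ Z then f x else lap P f x := fun _ _ => rfl
  have hinj : Function.Injective T := by
    rw [injective_iff_map_eq_zero]
    intro f hf
    have h : ∀ x, (if x ∈ Z then f x else lap P f x) = 0 := fun x => by
      rw [← hT, hf, Pi.zero_apply]
    ext x
    exact eq_zero_of_harmonic_off hP hE hZ (fun x hx => by simpa [hx] using h x)
      (fun x hx => by simpa [hx] using h x) x
  obtain ⟨f, hf⟩ := LinearMap.injective_iff_surjective.1 hinj
    (fun x => if x ∈ Z then b x else 0)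
  have h : ∀ x, (if x ∈ Z then f x else lap P f x) = if x ∈ Z then b x else 0 := fun x => by
    rw [← hT, hf]
  exact ⟨f, fun x hx => by simpa [hx] using h x, fun x hx => by simpa [hx] using h x⟩

/-- `u y` solves the Poisson equation with right-hand side `δ_y - 1/n`. -/
def IsPotentialKernel (P : Matrix V V ℝ) (u : V → V → ℝ) : Prop :=
  ∀ y x, lap P (u y) x = (if x = y then 1 else 0) - (Fintype.card V : ℝ)⁻¹

lemma exists_isPotentialKernel (hP : P ∈ doublyStochastic ℝ V) (hE : EnergyDefinite P) :
    ∃ u, IsPotentialKernel P u := by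
  have : ∀ y, ∃ u, ∀ x, lap P u x = (if x = y then 1 else 0) - (Fintype.card V : ℝ)⁻¹ := by
    intro y
    have : Nonempty V := ⟨y⟩
    refine exists_lap_eq hP hE _ ?_
    simp [Finset.sum_sub_distrib]
  choose u hu using this
  exact ⟨u, hu⟩

lemma IsPotentialKernel.sum_mul_lap {u : V → V → ℝ} (hu : IsPotentialKernel P u) (f : V → ℝ)
    (x y : V) : ∑ w, f w * lap P (fun z => u x z - u y z) w = f x - f y := by
  have : ∀ w, f w * lap P (fun z => u x z - u y z) w
      = (if w = x then f w else 0) - (if w = y then f w else 0) := fun w => by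
    rw [lap_sub, hu x w, hu y w]
    split_ifs <;> ring
  simp [this, Finset.sum_sub_distrib]

lemma IsPotentialKernel.energy_eq (hP : P ∈ doublyStochastic ℝ V) {u : V → V → ℝ}
    (hu : IsPotentialKernel P u) (x y : V) :
    energy P (fun z => u x z - u y z) = kernelResistance u x y := by
  rw [← sum_mul_lap_self hP, hu.sum_mul_lap]
  rfl

end Laplacian

section Resistance

variable {V : Type} [Fintype V] [DecidableEq V] {P : Matrix V V ℝ}

/-- By Foster's identity for the network traced on `Z`, a set of points whose mutual resistances
exceed `4` has at most `2 n / d` elements. -/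
lemma card_mul_le_of_resistance_separated (hP : P ∈ doublyStochastic ℝ V)
    (hS : ∀ x y, P x y = P y x) (hE : EnergyDefinite P) {d : ℝ} (hd : ∀ x y, d * P x y ≤ 1)
    (hd0 : 0 ≤ d) {u : V → V → ℝ} (hu : IsPotentialKernel P u) {Z : Finset V}
    (hZ : ∀ x ∈ Z, ∀ y ∈ Z, x ≠ y → 4 < kernelResistance u x y) :
    d * Z.card ≤ 2 * Fintype.card V := by
  rcases Z.eq_empty_or_nonempty with rfl | hne
  · simp
  have hVne : Nonempty V := ⟨hne.choose⟩
  have hn : (0 : ℝ) < Fintype.card V := by exact_mod_cast Fintype.card_pos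
  choose h hh1 hh0 using fun z : V =>
    exists_harmonic_off hP hE hne (fun x => if x = z then (1 : ℝ) else 0)
  have hpos : ∀ z x, 0 ≤ h z x := fun z x =>
    nonneg_of_harmonic_off hP hE hne (fun x hx => by rw [hh1 z x hx]; split_ifs <;> simp)
      (hh0 z) x
  have hpart : ∀ x, ∑ z ∈ Z, h z x = 1 := fun x => by
    have := eq_zero_of_harmonic_off hP hE hne (f := fun y => 1 - ∑ z ∈ Z, h z y)
      (fun y hy => by
        rw [Finset.sum_congr rfl fun z _ => hh1 z y hy]
        simp [hy])
      (fun y hy => by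
        rw [lap_sub, lap_const hP, lap_sum, Finset.sum_eq_zero fun z _ => hh0 z y hy, sub_zero]) x
    linarith
  have hsumZ : ∀ z (g : V → ℝ), ∑ w ∈ Z, g w * lap P (h z) w = ∑ x, h z x * lap P g x :=
    fun z g => by
      rw [sum_mul_lap_comm hS]
      refine Finset.sum_subset (Finset.subset_univ _) fun x _ hx => ?_
      rw [hh0 z x hx, mul_zero]
  have hrow : ∀ z, ∑ w ∈ Z, lap P (h z) w = 0 := fun z => by
    have := hsumZ z (fun _ => 1)
    simpa [lap_const hP] using this
  have hpick : ∀ z ∈ Z, ∀ F : V → ℝ, ∑ x ∈ Z, h z x * F x = F z := fun z hz F => by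
    rw [Finset.sum_congr rfl fun x hx => by rw [hh1 z x hx]]
    simp [hz]
  have hsymm : ∀ z ∈ Z, ∀ w ∈ Z, lap P (h z) w = lap P (h w) z := fun z hz w hw => by
    rw [← hpick w hw (lap P (h z)), hsumZ, sum_mul_lap_comm hS, ← hsumZ, hpick z hz]
  have hkernel : ∀ z ∈ Z, ∑ w ∈ Z, u z w * lap P (h z) w
      = 1 - (∑ x, h z x) * (Fintype.card V : ℝ)⁻¹ := fun z hz => by
    rw [hsumZ]
    simp only [hu z, mul_sub, Finset.sum_sub_distrib, ← Finset.sum_mul]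
    simp [hh1 z z hz]
  have htotal : ∑ z ∈ Z, ∑ x, h z x = Fintype.card V := by
    rw [Finset.sum_comm]
    simp [hpart]
  have hhalf : ∑ z ∈ Z, ∑ w ∈ Z, (u z z - u z w) * lap P (h z) w = 1 - Z.card := by
    simp only [sub_mul, Finset.sum_sub_distrib, ← Finset.mul_sum, hrow, mul_zero,
      Finset.sum_const_zero]
    rw [Finset.sum_congr rfl hkernel, Finset.sum_sub_distrib, ← Finset.sum_mul, htotal,
      mul_inv_cancel₀ hn.ne']
    simp
  have hhalf' : ∑ z ∈ Z, ∑ w ∈ Z, (u w w - u w z) * lap P (h z) w = 1 - Z.card := by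
    rw [← hhalf, Finset.sum_comm]
    refine Finset.sum_congr rfl fun z hz => Finset.sum_congr rfl fun w hw => ?_
    rw [hsymm w hw z hz]
  have hfoster : ∑ z ∈ Z, ∑ w ∈ Z, kernelResistance u z w * lap P (h z) w
      = 2 * (1 - Z.card) := by
    rw [two_mul]
    nth_rewrite 1 [← hhalf]
    rw [← hhalf', ← Finset.sum_add_distrib]
    refine Finset.sum_congr rfl fun z _ => ?_
    rw [← Finset.sum_add_distrib]
    refine Finset.sum_congr rfl fun w _ => ?_
    rw [kernelResistance]
    ring
  have hdiag : ∑ z ∈ Z, lap P (h z) z ≤ (Z.card - 1) / 2 := by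
    have hle : ∑ z ∈ Z, ∑ w ∈ Z, kernelResistance u z w * lap P (h z) w
        ≤ ∑ z ∈ Z, ∑ w ∈ Z, (4 * lap P (h z) w - if w = z then 4 * lap P (h z) w else 0) := by
      refine Finset.sum_le_sum fun z hz => Finset.sum_le_sum fun w hw => ?_
      by_cases hwz : w = z
      · subst hwz
        simp [kernelResistance]
      · have hneg : lap P (h z) w ≤ 0 := by
          rw [lap, hh1 z w hw, if_neg hwz, zero_sub, neg_nonpos]
          exact Finset.sum_nonneg fun x _ =>
            mul_nonneg (nonneg_of_mem_doublyStochastic hP) (hpos z x)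
        rw [if_neg hwz, sub_zero]
        exact mul_le_mul_of_nonpos_right (hZ z hz w hw (Ne.symm hwz)).le hneg
    have heq : ∑ z ∈ Z, ∑ w ∈ Z, (4 * lap P (h z) w - if w = z then 4 * lap P (h z) w else 0)
        = -(4 * ∑ z ∈ Z, lap P (h z) z) := by
      rw [Finset.mul_sum, ← Finset.sum_neg_distrib]
      refine Finset.sum_congr rfl fun z hz => ?_
      rw [Finset.sum_sub_distrib, ← Finset.mul_sum, hrow]
      simp [hz]
    linarith
  have hmass : ∀ z ∈ Z, d * (1 - lap P (h z) z) ≤ ∑ x, h z x := fun z hz => by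
    rw [lap, hh1 z z hz, if_pos rfl, sub_sub_cancel, Finset.mul_sum]
    refine Finset.sum_le_sum fun x _ => ?_
    nlinarith [mul_le_mul_of_nonneg_right (hd z x) (hpos z x)]
  have hmass' := Finset.sum_le_sum hmass
  rw [htotal, ← Finset.mul_sum, Finset.sum_sub_distrib] at hmass'
  simp only [Finset.sum_const, nsmul_eq_mul, mul_one] at hmass'
  nlinarith [mul_le_mul_of_nonneg_left hdiag hd0]

/-- Nonreversible commute times are at most those of the additive symmetrization. -/
lemma kernelResistance_le_of_symmetrization {Q : Matrix V V ℝ} (hP : P ∈ doublyStochastic ℝ V)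
    (hQ : Q ∈ doublyStochastic ℝ V) (hPQ : ∀ x y, Q x y = (P x y + P y x) / 2)
    {u k : V → V → ℝ} (hu : IsPotentialKernel P u) (hk : IsPotentialKernel Q k) (x y : V) :
    kernelResistance u x y ≤ kernelResistance k x y := by
  have hS : ∀ x y, Q x y = Q y x := fun x y => by rw [hPQ, hPQ, add_comm]
  set w : V → ℝ := fun z => u x z - u y z with hw
  set g : V → ℝ := fun z => k x z - k y z with hg
  have hen : energy Q w = energy P w := by
    have : ∑ a, ∑ b, P b a * (w a - w b) ^ 2 = ∑ a, ∑ b, P a b * (w a - w b) ^ 2 := by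
      rw [Finset.sum_comm]
      refine Finset.sum_congr rfl fun a _ => Finset.sum_congr rfl fun b _ => ?_
      ring
    have h2 : ∑ a, ∑ b, Q a b * (w a - w b) ^ 2
        = (∑ a, ∑ b, P a b * (w a - w b) ^ 2 + ∑ a, ∑ b, P b a * (w a - w b) ^ 2) / 2 := by
      rw [← Finset.sum_add_distrib, Finset.sum_div]
      refine Finset.sum_congr rfl fun a _ => ?_
      rw [← Finset.sum_add_distrib, Finset.sum_div]
      refine Finset.sum_congr rfl fun b _ => ?_
      rw [hPQ]
      ring
    rw [energy, energy, h2, this]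
    ring
  have hww : ∑ z, w z * lap Q w z = kernelResistance u x y := by
    rw [sum_mul_lap_self hQ, hen, hw, hu.energy_eq hP]
  have hgg : ∑ z, g z * lap Q g z = kernelResistance k x y := by
    rw [sum_mul_lap_self hQ, hg, hk.energy_eq hQ]
  have hwg : ∑ z, w z * lap Q g z = kernelResistance u x y := by
    rw [hg, hk.sum_mul_lap]
    rfl
  have hgw : ∑ z, g z * lap Q w z = kernelResistance u x y := by
    rw [sum_mul_lap_comm hS, hwg]
  have hnn : 0 ≤ ∑ z, (w z - g z) * lap Q (fun a => w a - g a) z := by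
    rw [sum_mul_lap_self hQ (fun a => w a - g a)]
    exact energy_nonneg hQ _
  simp only [lap_sub, sub_mul, mul_sub, Finset.sum_sub_distrib] at hnn
  linarith

/-- An edge of conductance `c` has resistance at most `1 / c`. -/
lemma mul_kernelResistance_le_one (hP : P ∈ doublyStochastic ℝ V) (hS : ∀ x y, P x y = P y x)
    {u : V → V → ℝ} (hu : IsPotentialKernel P u) (x y : V) :
    P x y * kernelResistance u x y ≤ 1 := by
  rcases eq_or_ne x y with rfl | hxy
  · simp [kernelResistance]
  set w : V → ℝ := fun z => u x z - u y z with hw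
  have hP0 : ∀ a b, 0 ≤ P a b * (w a - w b) ^ 2 := fun a b =>
    mul_nonneg (nonneg_of_mem_doublyStochastic hP) (sq_nonneg _)
  have hR : kernelResistance u x y = w x - w y := rfl
  have hR0 : 0 ≤ kernelResistance u x y := by
    rw [← hu.energy_eq hP]
    exact energy_nonneg hP _
  have hle : P x y * (w x - w y) ^ 2 ≤ energy P w := by
    have h1 : ∀ a b, P a b * (w a - w b) ^ 2 ≤ ∑ c, P a c * (w a - w c) ^ 2 := fun a b =>
      Finset.single_le_sum (f := fun c => P a c * (w a - w c) ^ 2) (fun c _ => hP0 a c)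
        (Finset.mem_univ b)
    have h2 := Finset.sum_le_sum_of_subset_of_nonneg (Finset.subset_univ ({x, y} : Finset V))
      (f := fun a => ∑ c, P a c * (w a - w c) ^ 2)
      (fun a _ _ => Finset.sum_nonneg fun c _ => hP0 a c)
    rw [Finset.sum_pair hxy] at h2
    have h3 := h1 x y
    have h4 := h1 y x
    rw [hS y x] at h4
    rw [energy]
    nlinarith
  rw [hw, hu.energy_eq hP, ← hw, ← hR] at hle
  rcases hR0.eq_or_lt with h0 | h0
  · simp [← h0]
  · nlinarith

end Resistance

section Tour

/-- The total cost of travelling from `x` through the vertices of a list in order. -/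
def tourCost {V : Type} (H : V → V → ℝ) : V → List V → ℝ
  | _, [] => 0
  | x, y :: l => H x y + tourCost H y l

lemma tourCost_nonneg {V : Type} {H : V → V → ℝ} (hH : ∀ x y, 0 ≤ H x y) :
    ∀ (l : List V) (x : V), 0 ≤ tourCost H x l
  | [], _ => le_rfl
  | y :: l, x => add_nonneg (hH x y) (tourCost_nonneg hH l y)

/-- A tour through `z` can be extended by a detour to `y`. -/
lemma exists_tour_insert {V : Type} (H : V → V → ℝ) (y z : V) :
    ∀ (l : List V) (x : V), z ∈ x :: l →
      ∃ l', (∀ w, w ∈ x :: l' ↔ w = y ∨ w ∈ x :: l) ∧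
        tourCost H x l' = tourCost H x l + (H z y + H y z) := by
  have hhead : ∀ l : List V, ∃ l', (∀ w, w ∈ z :: l' ↔ w = y ∨ w ∈ z :: l) ∧
      tourCost H z l' = tourCost H z l + (H z y + H y z) := fun l => by
    refine ⟨y :: z :: l, fun w => ?_, ?_⟩
    · simp only [List.mem_cons]
      tauto
    · simp only [tourCost]
      ring
  intro l
  induction l with
  | nil =>
    intro x hx
    obtain rfl : z = x := by simpa using hx
    exact hhead []
  | cons a l ih =>
    intro x hx
    rcases List.mem_cons.1 hx with rfl | hx
    · exact hhead (a :: l)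
    · obtain ⟨l', hmem, hcost⟩ := ih a hx
      refine ⟨a :: l', fun w => ?_, ?_⟩
      · rw [List.mem_cons, hmem w, List.mem_cons (b := x)]
        tauto
      · simp only [tourCost, hcost]
        ring

variable {V : Type} [Fintype V] [DecidableEq V]

/-- Greedy construction of a tour of all vertices. Every detour costs at most `4 N`, apart from
those to the points of a `4`-separated set, which cost at most `c N`. -/
lemma exists_tour {H R : V → V → ℝ} {N c : ℝ} (hN : 0 ≤ N)
    (hR : ∀ x y, R x y = R y x) (hHR : ∀ x y, H x y + H y x ≤ N * R x y)
    (hcross : ∀ B : Finset V, B.Nonempty → B ≠ Finset.univ →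
      ∃ x ∈ B, ∃ y ∉ B, R x y ≤ c) (hc : 0 ≤ c) (v : V) :
    ∃ (l : List V) (Z : Finset V), (∀ w, w ∈ v :: l) ∧
      (∀ x ∈ Z, ∀ y ∈ Z, x ≠ y → 4 < R x y) ∧
      tourCost H v l ≤ N * (4 * Fintype.card V + c * Z.card) := by
  suffices h : ∀ m : ℕ, m + 1 ≤ Fintype.card V → ∃ (B Z : Finset V) (l : List V),
      B.card = m + 1 ∧ (∀ w, w ∈ v :: l ↔ w ∈ B) ∧ Z ⊆ B ∧
      (∀ x ∈ Z, ∀ y ∈ Z, x ≠ y → 4 < R x y) ∧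
      tourCost H v l ≤ N * (4 * (m + 1 : ℕ) + c * Z.card) by
    have hpos : 0 < Fintype.card V := Fintype.card_pos_iff.2 ⟨v⟩
    obtain ⟨B, Z, l, hB, hl, -, hZ, hcost⟩ := h (Fintype.card V - 1) (by omega)
    rw [Nat.sub_add_cancel hpos] at hB hcost
    have hBu : B = Finset.univ := Finset.eq_univ_of_card B hB
    exact ⟨l, Z, fun w => (hl w).2 (hBu ▸ Finset.mem_univ w), hZ, hcost⟩
  intro m
  induction m with
  | zero =>
    intro _
    refine ⟨{v}, {v}, [], by simp, by simp, le_rfl, by simp, ?_⟩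
    simp only [tourCost]
    positivity
  | succ m ih =>
    intro hm
    obtain ⟨B, Z, l, hB, hl, hZB, hZ, hcost⟩ := ih (by omega)
    have hBne : B.Nonempty := Finset.card_pos.1 (by omega)
    have hBu : B ≠ Finset.univ := fun h => by
      rw [h, Finset.card_univ] at hB
      omega
    have hstep : ∀ x ∈ B, ∀ y ∉ B, ∀ r, R x y ≤ r → ∃ l' : List V,
        (insert y B).card = m + 1 + 1 ∧ (∀ w, w ∈ v :: l' ↔ w ∈ insert y B) ∧
        tourCost H v l' ≤ N * (4 * (m + 1 : ℕ) + c * Z.card) + N * r := by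
      intro x hx y hy r hr
      obtain ⟨l', hmem, hcost'⟩ := exists_tour_insert H y x l v ((hl x).2 hx)
      refine ⟨l', by rw [Finset.card_insert_of_notMem hy, hB], fun w => ?_, ?_⟩
      · rw [hmem, hl, Finset.mem_insert]
      · rw [hcost']
        exact add_le_add hcost ((hHR x y).trans (mul_le_mul_of_nonneg_left hr hN))
    by_cases hlight : ∃ x ∈ B, ∃ y ∉ B, R x y ≤ 4
    · obtain ⟨x, hx, y, hy, hxy⟩ := hlight
      obtain ⟨l', hcard, hmem, hcost'⟩ := hstep x hx y hy 4 hxy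
      refine ⟨insert y B, Z, l', hcard, hmem, hZB.trans (Finset.subset_insert _ _), hZ,
        hcost'.trans (le_of_eq ?_)⟩
      push_cast
      ring
    · push Not at hlight
      obtain ⟨x, hx, y, hy, hxy⟩ := hcross B hBne hBu
      obtain ⟨l', hcard, hmem, hcost'⟩ := hstep x hx y hy c hxy
      have hyZ : y ∉ Z := fun h => hy (hZB h)
      refine ⟨insert y B, insert y Z, l', hcard, hmem, Finset.insert_subset_insert _ hZB, ?_,
        hcost'.trans ?_⟩
      · intro a ha b hb hab
        rcases Finset.mem_insert.1 ha with hay | haZ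
        · rcases Finset.mem_insert.1 hb with hby | hbZ
          · exact absurd (hay.trans hby.symm) hab
          · rw [hR, hay]
            exact hlight b (hZB hbZ) y hy
        · rcases Finset.mem_insert.1 hb with hby | hbZ
          · rw [hby]
            exact hlight a (hZB haZ) y hy
          · exact hZ a haZ b hbZ hab
      · rw [Finset.card_insert_of_notMem hyZ]
        push_cast
        nlinarith

/-- The expected exploration time is at most the cost of a tour, measured in hitting times. -/
lemma sum_surviveFrom_le_tourCost {P : Matrix V V ℝ} (hP : P ∈ doublyStochastic ℝ V)
    {H : V → V → ℝ} (hH0 : ∀ x y, 0 ≤ H x y) (hHself : ∀ x, H x x = 0)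
    (hH : ∀ x y, x ≠ y → 1 + ∑ w, P x w * H w y ≤ H x y) {k : ℕ} (hk : k ≤ Fintype.card V)
    {v : V} {l : List V} (hl : ∀ w, w ∈ v :: l) (T : ℕ) :
    ∑ t ∈ Finset.range T, surviveFrom P k t ∅ v ≤ tourCost H v l := by
  refine sum_surviveFrom_le (fun x y => nonneg_of_mem_doublyStochastic hP)
    (fun A x b => x ∈ A ∧ ∃ l : List V, (∀ y, y ∈ A ∨ y ∈ l) ∧ b = tourCost H x l) ?_ ?_
    T ∅ v _ ⟨by simp, l, fun y => by simpa using hl y, rfl⟩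
  · rintro A x b ⟨-, l, -, rfl⟩
    exact tourCost_nonneg hH0 l x
  · rintro A x b ⟨hxA, l, hAl, rfl⟩ hA
    induction l with
    | nil =>
      have : A = Finset.univ := Finset.eq_univ_iff_forall.2 fun y => by simpa using hAl y
      rw [this, Finset.card_univ] at hA
      omega
    | cons a l ih =>
      by_cases hxa : x = a
      · subst hxa
        simp only [tourCost, hHself, zero_add]
        refine ih fun y => ?_
        rcases hAl y with h | h
        · exact Or.inl h
        · rcases List.mem_cons.1 h with rfl | h
          · exact Or.inl hxA
          · exact Or.inr h
      · refine ⟨fun y => tourCost H y (a :: l), fun y => ⟨Finset.mem_insert_self _ _, a :: l,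
          fun z => (hAl z).imp Finset.mem_insert_of_mem id, rfl⟩, ?_⟩
        simp only [tourCost, mul_add, Finset.sum_add_distrib, ← Finset.sum_mul,
          sum_row_of_mem_doublyStochastic hP, one_mul]
        linarith [hH x a hxa]

end Tour

section HittingTime

variable {V : Type} [Fintype V]

/-- The expected hitting time of `y` from `x`, read off a potential kernel. -/
noncomputable def kernelHit (u : V → V → ℝ) (x y : V) : ℝ :=
  Fintype.card V * (u y y - u y x)

lemma kernelHit_add_kernelHit (u : V → V → ℝ) (x y : V) :
    kernelHit u x y + kernelHit u y x = Fintype.card V * kernelResistance u x y := by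
  simp only [kernelHit, kernelResistance]
  ring

variable [DecidableEq V] {P : Matrix V V ℝ}

lemma IsPotentialKernel.le_self (hP : P ∈ doublyStochastic ℝ V) {u : V → V → ℝ}
    (hu : IsPotentialKernel P u) (x y : V) : u y x ≤ u y y := by
  have : Nonempty V := ⟨x⟩
  have hn : (0 : ℝ) < (Fintype.card V : ℝ)⁻¹ := by
    have : (0 : ℝ) < Fintype.card V := by exact_mod_cast Fintype.card_pos
    positivity
  obtain ⟨z, hz⟩ := Finite.exists_max (u y)
  by_cases hzy : z = y
  · exact hzy ▸ hz x
  · have h1 := hu y z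
    rw [if_neg hzy, lap] at h1
    have h2 : ∑ w, P z w * u y w ≤ ∑ w, P z w * u y z :=
      Finset.sum_le_sum fun w _ =>
        mul_le_mul_of_nonneg_left (hz w) (nonneg_of_mem_doublyStochastic hP)
    rw [← Finset.sum_mul, sum_row_of_mem_doublyStochastic hP] at h2
    linarith

lemma kernelHit_nonneg (hP : P ∈ doublyStochastic ℝ V) {u : V → V → ℝ}
    (hu : IsPotentialKernel P u) (x y : V) : 0 ≤ kernelHit u x y :=
  mul_nonneg (Nat.cast_nonneg _) (sub_nonneg.2 (hu.le_self hP x y))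

lemma one_add_sum_kernelHit (hP : P ∈ doublyStochastic ℝ V) {u : V → V → ℝ}
    (hu : IsPotentialKernel P u) {x y : V} (hxy : x ≠ y) :
    1 + ∑ w, P x w * kernelHit u w y = kernelHit u x y := by
  have : Nonempty V := ⟨x⟩
  have hn : (Fintype.card V : ℝ) ≠ 0 := by exact_mod_cast Fintype.card_ne_zero
  have h1 := hu y x
  rw [if_neg hxy, lap] at h1
  have h2 : ∑ w, P x w * kernelHit u w y
      = Fintype.card V * (u y y - ∑ w, P x w * u y w) := by
    have : ∀ w, P x w * kernelHit u w y
        = Fintype.card V * (P x w * u y y - P x w * u y w) := fun w => by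
      rw [kernelHit]
      ring
    simp only [this]
    rw [← Finset.mul_sum, Finset.sum_sub_distrib, ← Finset.sum_mul,
      sum_row_of_mem_doublyStochastic hP, one_mul]
  have h3 : ∑ w, P x w * u y w = u y x + (Fintype.card V : ℝ)⁻¹ := by linarith
  rw [h2, h3, kernelHit]
  field_simp
  ring

end HittingTime

section Resolvent

variable {V : Type} [Fintype V] [DecidableEq V] {P : Matrix V V ℝ}

/-- `g a x = ∑ s, r ^ s * P ^ s x a`, characterized by its renewal equation. -/
def IsResolvent (P : Matrix V V ℝ) (r : ℝ) (g : V → V → ℝ) : Prop :=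
  ∀ a x, g a x = (if x = a then 1 else 0) + r * ∑ y, P x y * g a y

lemma exists_isResolvent (hP : P ∈ doublyStochastic ℝ V) {r : ℝ} (hr0 : 0 ≤ r) (hr1 : r < 1) :
    ∃ g, IsResolvent P r g := by
  let T : (V → ℝ) →ₗ[ℝ] (V → ℝ) := LinearMap.id - r • Matrix.mulVecLin P
  have hT : ∀ f x, T f x = f x - r * ∑ y, P x y * f y := fun _ _ => rfl
  have hinj : Function.Injective T := by
    rw [injective_iff_map_eq_zero]
    intro f hf
    ext x
    have : Nonempty V := ⟨x⟩
    obtain ⟨z, hz⟩ := Finite.exists_max fun y => |f y|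
    have h1 : f z = r * ∑ y, P z y * f y := by
      have := hT f z
      rw [hf, Pi.zero_apply] at this
      linarith
    have h2 : |f z| ≤ r * |f z| := by
      nth_rewrite 1 [h1]
      rw [abs_mul, abs_of_nonneg hr0]
      refine mul_le_mul_of_nonneg_left ((Finset.abs_sum_le_sum_abs _ _).trans ?_) hr0
      calc ∑ y, |P z y * f y| ≤ ∑ y, P z y * |f z| := Finset.sum_le_sum fun y _ => by
            rw [abs_mul, abs_of_nonneg (nonneg_of_mem_doublyStochastic hP)]
            exact mul_le_mul_of_nonneg_left (hz y) (nonneg_of_mem_doublyStochastic hP)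
        _ = |f z| := by rw [← Finset.sum_mul, sum_row_of_mem_doublyStochastic hP, one_mul]
    have h3 : |f z| ≤ 0 := by nlinarith [abs_nonneg (f z)]
    exact abs_eq_zero.1 (le_antisymm ((hz x).trans h3) (abs_nonneg _))
  choose g hg using fun a : V =>
    LinearMap.injective_iff_surjective.1 hinj (fun x => if x = a then 1 else 0)
  refine ⟨g, fun a x => ?_⟩
  have := hT (g a) x
  rw [hg a] at this
  linarith

variable {r : ℝ} {g : V → V → ℝ}

lemma IsResolvent.nonneg (hP : P ∈ doublyStochastic ℝ V) (hr0 : 0 ≤ r) (hr1 : r < 1)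
    (hg : IsResolvent P r g) (a x : V) : 0 ≤ g a x := by
  have : Nonempty V := ⟨x⟩
  obtain ⟨z, hz⟩ := Finite.exists_min (g a)
  refine le_trans ?_ (hz x)
  have h1 := hg a z
  have h2 : g a z ≤ ∑ y, P z y * g a y := by
    calc g a z = ∑ y, P z y * g a z := by
          rw [← Finset.sum_mul, sum_row_of_mem_doublyStochastic hP, one_mul]
      _ ≤ _ := Finset.sum_le_sum fun y _ =>
          mul_le_mul_of_nonneg_left (hz y) (nonneg_of_mem_doublyStochastic hP)
  have h3 : (0 : ℝ) ≤ if z = a then 1 else 0 := by split_ifs <;> simp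
  nlinarith [mul_le_mul_of_nonneg_left h2 hr0]

lemma IsResolvent.le_self (hP : P ∈ doublyStochastic ℝ V) (hr0 : 0 ≤ r) (hr1 : r < 1)
    (hg : IsResolvent P r g) (a x : V) : g a x ≤ g a a := by
  have : Nonempty V := ⟨x⟩
  obtain ⟨z, hz⟩ := Finite.exists_max (g a)
  by_cases hza : z = a
  · exact hza ▸ hz x
  · have h1 := hg a z
    rw [if_neg hza, zero_add] at h1
    have h2 : ∑ y, P z y * g a y ≤ g a z := by
      calc _ ≤ ∑ y, P z y * g a z := Finset.sum_le_sum fun y _ =>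
            mul_le_mul_of_nonneg_left (hz y) (nonneg_of_mem_doublyStochastic hP)
        _ = _ := by rw [← Finset.sum_mul, sum_row_of_mem_doublyStochastic hP, one_mul]
    have h3 : g a z ≤ 0 := by nlinarith [mul_le_mul_of_nonneg_left h2 hr0]
    exact ((hz x).trans h3).trans (hg.nonneg hP hr0 hr1 a a)

lemma IsResolvent.sum_eq (hP : P ∈ doublyStochastic ℝ V) (hg : IsResolvent P r g) (a : V) :
    (1 - r) * ∑ x, g a x = 1 := by
  have h : ∑ x, g a x = 1 + r * ∑ x, g a x := by
    conv_lhs => rw [Finset.sum_congr rfl fun x _ => hg a x]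
    rw [Finset.sum_add_distrib, ← Finset.mul_sum, Finset.sum_comm]
    simp [← Finset.sum_mul, sum_col_of_mem_doublyStochastic hP]
  linarith

lemma IsResolvent.mul_energy_le (hP : P ∈ doublyStochastic ℝ V) (hr1 : r < 1)
    (hg : IsResolvent P r g) (a : V) : r * energy P (g a) ≤ g a a := by
  have h1 : ∀ x, (if x = a then g a x else 0)
      = (1 - r) * g a x ^ 2 + r * (g a x * lap P (g a) x) := fun x => by
    have h := hg a x
    have h' : (if x = a then g a x else 0) = g a x * if x = a then (1 : ℝ) else 0 := by
      split_ifs <;> simp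
    have h'' : (if x = a then (1 : ℝ) else 0) = g a x - r * ∑ y, P x y * g a y := by linarith
    rw [h', h'', lap]
    ring
  have h2 : g a a = (1 - r) * ∑ x, g a x ^ 2 + r * energy P (g a) := by
    rw [← sum_mul_lap_self hP, Finset.mul_sum, Finset.mul_sum, ← Finset.sum_add_distrib,
      ← Finset.sum_congr rfl fun x _ => h1 x]
    simp
  have h3 : 0 ≤ ∑ x, g a x ^ 2 := Finset.sum_nonneg fun x _ => sq_nonneg _
  nlinarith

/-- Bound on the exploration time from the resolvent at discount `1 - 1 / s`. -/
lemma sum_surviveFrom_le_of_isResolvent (hP : P ∈ doublyStochastic ℝ V) {s G : ℝ} {k : ℕ}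
    (hs : 1 ≤ s) (hg : IsResolvent P (1 - s⁻¹) g) (hG : ∀ a, g a a ≤ G) (hkG : 2 * (k * G) ≤ s)
    (hk : 1 ≤ k) (v : V) (T : ℕ) :
    ∑ t ∈ Finset.range T, surviveFrom P k t ∅ v ≤ s := by
  have hs0 : 0 < s := by linarith
  have hr0 : 0 ≤ 1 - s⁻¹ := sub_nonneg.2 (inv_le_one_of_one_le₀ hs)
  have hr1 : 1 - s⁻¹ < 1 := sub_lt_self _ (inv_pos.2 hs0)
  have hg0 := hg.nonneg hP hr0 hr1
  have hgG : ∀ a x, g a x ≤ G := fun a x => (hg.le_self hP hr0 hr1 a x).trans (hG a)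
  have hG0 : 0 ≤ G := (hg0 v v).trans (hgG v v)
  let D : Finset V → V → ℝ := fun A x => G * (k - A.card) + ∑ a ∈ A, g a x
  have hDle : ∀ A x, D A x ≤ k * G := fun A x => by
    have : ∑ a ∈ A, g a x ≤ ∑ a ∈ A, G := Finset.sum_le_sum fun a _ => hgG a x
    rw [Finset.sum_const, nsmul_eq_mul] at this
    simp only [D]
    linarith
  have hDins : ∀ A y, D (insert y A) y ≤ D A y := fun A y => by
    by_cases hy : y ∈ A
    · rw [Finset.insert_eq_of_mem hy]
    · simp only [D]
      rw [Finset.card_insert_of_notMem hy, Finset.sum_insert hy]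
      push_cast
      linarith [hgG y y]
  have hstep : ∀ A x, x ∈ A → (A.card : ℝ) ≤ k →
      1 + (1 - s⁻¹) * ∑ y, P x y * D A y ≤ D A x := fun A x hx hA => by
    have h1 : ∑ y, P x y * D A y = G * (k - A.card) + ∑ a ∈ A, ∑ y, P x y * g a y := by
      simp only [D, mul_add, Finset.sum_add_distrib, ← Finset.sum_mul,
        sum_row_of_mem_doublyStochastic hP, one_mul, Finset.mul_sum]
      rw [Finset.sum_comm]
    have h2 : ∑ a ∈ A, g a x = 1 + (1 - s⁻¹) * ∑ a ∈ A, ∑ y, P x y * g a y := by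
      rw [Finset.sum_congr rfl fun a _ => hg a x, Finset.sum_add_distrib, ← Finset.mul_sum]
      simp [hx]
    have h3 : (1 - s⁻¹) * (G * (k - A.card)) ≤ G * (k - A.card) :=
      mul_le_of_le_one_left (mul_nonneg hG0 (by linarith)) hr1.le
    rw [h1]
    simp only [D]
    rw [h2]
    linarith
  refine (sum_surviveFrom_le (fun x y => nonneg_of_mem_doublyStochastic hP)
    (fun A x b => x ∈ A ∧ A.card ≤ k ∧ b = 2 * D A x) ?_ ?_ T ∅ v _
    ⟨by simp, by simpa using hk, rfl⟩).trans (by linarith [hDle (insert v ∅) v])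
  · rintro A x b ⟨-, hA, rfl⟩
    have hA' : (A.card : ℝ) ≤ k := by exact_mod_cast hA
    exact mul_nonneg zero_le_two (add_nonneg (mul_nonneg hG0 (by linarith))
      (Finset.sum_nonneg fun a _ => hg0 a x))
  · rintro A x b ⟨hx, hA, rfl⟩ hlt
    refine ⟨fun y => 2 * D (insert y A) y, fun y => ⟨Finset.mem_insert_self _ _,
      (Finset.card_insert_le _ _).trans hlt, rfl⟩, ?_⟩
    have h1 : ∑ y, P x y * (2 * D (insert y A) y) ≤ 2 * ∑ y, P x y * D A y := by
      rw [Finset.mul_sum]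
      refine Finset.sum_le_sum fun y _ => ?_
      have := mul_le_mul_of_nonneg_left (hDins A y)
        (nonneg_of_mem_doublyStochastic hP (i := x) (j := y))
      linarith
    have h2 : ∑ y, P x y * D A y ≤ k * G := by
      calc _ ≤ ∑ y, P x y * (k * G) := Finset.sum_le_sum fun y _ =>
            mul_le_mul_of_nonneg_left (hDle A y) (nonneg_of_mem_doublyStochastic hP)
        _ = _ := by rw [← Finset.sum_mul, sum_row_of_mem_doublyStochastic hP, one_mul]
    have h3 : s⁻¹ * ∑ y, P x y * D A y ≤ 1 / 2 := by
      rw [inv_mul_le_iff₀ hs0]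
      linarith
    have h4 := hstep A x hx (by exact_mod_cast hA)
    linarith

end Resolvent

section RegularDigraph

/-- The vertices of a geodesic are at increasing distances from its origin. -/
lemma dist_getVert_of_length_eq_dist {V : Type} {G : SimpleGraph V} (hG : G.Connected) {x y : V}
    (p : G.Walk x y) (hp : p.length = G.dist x y) {i : ℕ} (hi : i ≤ p.length) :
    G.dist x (p.getVert i) = i := by
  have h1 := SimpleGraph.dist_le (p.take i)
  have h2 := SimpleGraph.dist_le (p.drop i)
  rw [SimpleGraph.Walk.take_length] at h1
  rw [SimpleGraph.Walk.drop_length] at h2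
  have h3 := hG.dist_triangle (u := x) (v := p.getVert i) (w := y)
  omega

/-- A doubly stochastic matrix charging the edges of a connected digraph has no nonconstant
function of zero energy. -/
lemma energyDefinite_of_connected {V : Type} [Fintype V] [DecidableEq V] {E : V → V → Prop}
    (hconn : (SimpleGraph.fromRel E).Connected) {M : Matrix V V ℝ}
    (hM : M ∈ doublyStochastic ℝ V) (hE : ∀ x y, E x y → 0 < M x y) : EnergyDefinite M := by
  intro f hf
  have hM0 : ∀ a b, 0 ≤ M a b * (f a - f b) ^ 2 := fun a b =>
    mul_nonneg (nonneg_of_mem_doublyStochastic hM) (sq_nonneg _)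
  have hsum : ∑ x, ∑ y, M x y * (f x - f y) ^ 2 = 0 := by
    rw [energy] at hf
    linarith
  have hedge : ∀ x y, E x y → f x = f y := fun x y hxy => by
    have h1 := (Finset.sum_eq_zero_iff_of_nonneg
      fun a _ => Finset.sum_nonneg fun b _ => hM0 a b).1 hsum x (Finset.mem_univ x)
    have h2 := (Finset.sum_eq_zero_iff_of_nonneg fun b _ => hM0 x b).1 h1 y (Finset.mem_univ y)
    have h3 := (mul_eq_zero.1 h2).resolve_left (hE x y hxy).ne'
    exact sub_eq_zero.1 (pow_eq_zero_iff two_ne_zero |>.1 h3)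
  intro x y
  obtain ⟨p⟩ := hconn.preconnected x y
  induction p with
  | nil => rfl
  | cons h _ ih =>
    rw [← ih]
    rw [SimpleGraph.fromRel_adj] at h
    exact h.2.elim (hedge _ _) fun h => (hedge _ _ h).symm

variable {V : Type} [Fintype V] {E : V → V → Prop} [DecidableRel E] {d : ℕ}

/-- The sum of `(f a - f b) ^ 2` over the edges of the digraph. -/
noncomputable def edgeEnergy (E : V → V → Prop) [DecidableRel E] (f : V → ℝ) : ℝ :=
  ∑ a, ∑ b, if E a b then (f a - f b) ^ 2 else 0

variable [DecidableEq V]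

/-- Summing squared increments along an injective path of the underlying graph. -/
lemma sum_sq_sub_path_le (f : V → ℝ) (q : ℕ → V) (L : ℕ)
    (hadj : ∀ i < L, (SimpleGraph.fromRel E).Adj (q i) (q (i + 1)))
    (hinj : Set.InjOn q (Finset.range L)) :
    ∑ i ∈ Finset.range L, (f (q i) - f (q (i + 1))) ^ 2 ≤ 2 * edgeEnergy E f := by
  let F : V → V → ℝ := fun a b =>
    (if E a b then (f a - f b) ^ 2 else 0) + if E b a then (f b - f a) ^ 2 else 0
  have hF0 : ∀ a b, 0 ≤ F a b := fun a b => by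
    simp only [F]
    split_ifs <;> positivity
  calc ∑ i ∈ Finset.range L, (f (q i) - f (q (i + 1))) ^ 2
      ≤ ∑ i ∈ Finset.range L, ∑ b, F (q i) b := Finset.sum_le_sum fun i hi => by
        refine le_trans ?_ (Finset.single_le_sum (fun b _ => hF0 (q i) b)
          (Finset.mem_univ (q (i + 1))))
        have h := hadj i (Finset.mem_range.1 hi)
        rw [SimpleGraph.fromRel_adj] at h
        simp only [F]
        rcases h.2 with h | h
        · rw [if_pos h]
          split_ifs <;> nlinarith [sq_nonneg (f (q (i + 1)) - f (q i))]
        · rw [if_pos h]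
          split_ifs <;> nlinarith [sq_nonneg (f (q (i + 1)) - f (q i))]
    _ = ∑ a ∈ (Finset.range L).image q, ∑ b, F a b :=
        (Finset.sum_image (f := fun a => ∑ b, F a b) hinj).symm
    _ ≤ ∑ a, ∑ b, F a b := Finset.sum_le_sum_of_subset_of_nonneg (Finset.subset_univ _)
        fun a _ _ => Finset.sum_nonneg fun b _ => hF0 a b
    _ = 2 * edgeEnergy E f := by
        simp only [F, Finset.sum_add_distrib, edgeEnergy]
        rw [two_mul]
        congr 1
        exact Finset.sum_comm

/-- A set `S` containing `x` can be left from `x` along a geodesic of length `O(|S| / d)`, which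
bounds the oscillation of a function by its energy. -/
lemma exists_notMem_sq_sub_le (hreg : ∀ x, dout E x = d)
    (hconn : (SimpleGraph.fromRel E).Connected) {S : Finset V} (hS : S ≠ Finset.univ) (x : V)
    (f : V → ℝ) :
    ∃ y ∉ S, d * (f x - f y) ^ 2 ≤ 2 * (3 * S.card + d) * edgeEnergy E f := by
  set G := SimpleGraph.fromRel E with hG
  have hne : (Sᶜ : Finset V).Nonempty := by
    rwa [Finset.nonempty_iff_ne_empty, Ne, Finset.compl_eq_empty_iff]
  obtain ⟨y, hyS, hmin⟩ := Finset.exists_min_image Sᶜ (fun y => G.dist x y) hne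
  rw [Finset.mem_compl] at hyS
  obtain ⟨p, hp⟩ := hconn.exists_walk_length_eq_dist x y
  set L := p.length with hL
  have hdist : ∀ i ≤ L, G.dist x (p.getVert i) = i := fun i hi =>
    dist_getVert_of_length_eq_dist hconn p hp hi
  have hmemS : ∀ w, G.dist x w < L → w ∈ S := fun w hw => by
    by_contra h
    have := hmin w (Finset.mem_compl.2 h)
    omega
  have hadjE : ∀ a w, E a w → a ≠ w → G.Adj a w := fun a w h hne' => by
    rw [hG, SimpleGraph.fromRel_adj]
    exact ⟨hne', Or.inl h⟩
  have hnear : ∀ a w, E a w → G.dist x w ≤ G.dist x a + 1 ∧ G.dist x a ≤ G.dist x w + 1 :=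
    fun a w h => by
      by_cases haw : a = w
      · subst haw
        omega
      · have h1 := SimpleGraph.dist_eq_one_iff_adj.2 (hadjE a w h haw)
        have h2 := hconn.dist_triangle (u := x) (v := a) (w := w)
        have h3 := hconn.dist_triangle (u := x) (v := w) (w := a)
        rw [SimpleGraph.dist_comm (u := w)] at h3
        omega
  have hcount : (L - 1) * d ≤ S.card * 3 := by
    calc (L - 1) * d = ∑ i ∈ Finset.range (L - 1),
          (Finset.bipartiteAbove (fun i w => E (p.getVert i) w) S i).card := by
          rw [Finset.sum_congr rfl (g := fun _ => d)]
          · simp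
          · intro i hi
            rw [← hreg (p.getVert i), dout, Finset.bipartiteAbove]
            congr 1
            ext w
            simp only [Finset.mem_filter, Finset.mem_univ, true_and, and_iff_right_iff_imp]
            intro h
            have h1 := (hnear _ _ h).1
            have h2 := Finset.mem_range.1 hi
            rw [hdist i (by omega)] at h1
            exact hmemS w (by omega)
      _ = ∑ w ∈ S, (Finset.bipartiteBelow (fun i w => E (p.getVert i) w)
          (Finset.range (L - 1)) w).card :=
          Finset.sum_card_bipartiteAbove_eq_sum_card_bipartiteBelow _
      _ ≤ ∑ w ∈ S, 3 := Finset.sum_le_sum fun w _ => by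
          refine (Finset.card_le_card (t := Finset.Icc (G.dist x w - 1) (G.dist x w + 1))
            fun i hi => ?_).trans (by rw [Nat.card_Icc]; omega)
          rw [Finset.mem_bipartiteBelow, Finset.mem_range] at hi
          have h1 := hnear _ _ hi.2
          rw [hdist i (by omega)] at h1
          rw [Finset.mem_Icc]
          omega
      _ = S.card * 3 := by simp
  have hLd : (L : ℝ) * d ≤ 3 * S.card + d := by
    have : L * d ≤ S.card * 3 + d := by
      have : L ≤ (L - 1) + 1 := by omega
      nlinarith
    have : (L : ℝ) * d ≤ S.card * 3 + d := by exact_mod_cast this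
    linarith
  have hsum : f x - f y
      = ∑ i ∈ Finset.range L, (f (p.getVert i) - f (p.getVert (i + 1))) := by
    rw [Finset.sum_range_sub' (fun i => f (p.getVert i)), SimpleGraph.Walk.getVert_zero,
      SimpleGraph.Walk.getVert_length]
  have hpath := sum_sq_sub_path_le (E := E) f p.getVert L
    (fun i hi => p.adj_getVert_succ hi) (fun i hi j hj hij => by
      rw [Finset.mem_coe, Finset.mem_range] at hi hj
      rw [← hdist i hi.le, ← hdist j hj.le, hij])
  have hcs := sq_sum_le_card_mul_sum_sq (s := Finset.range L)
    (f := fun i => f (p.getVert i) - f (p.getVert (i + 1)))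
  rw [← hsum, Finset.card_range] at hcs
  have hE0 : 0 ≤ edgeEnergy E f := Finset.sum_nonneg fun a _ => Finset.sum_nonneg fun b _ => by
    split_ifs <;> positivity
  refine ⟨y, hyS, ?_⟩
  calc d * (f x - f y) ^ 2 ≤ d * (L * (2 * edgeEnergy E f)) :=
        mul_le_mul_of_nonneg_left (hcs.trans (mul_le_mul_of_nonneg_left hpath (by positivity)))
          (by positivity)
    _ = (L * d) * (2 * edgeEnergy E f) := by ring
    _ ≤ (3 * S.card + d) * (2 * edgeEnergy E f) :=
        mul_le_mul_of_nonneg_right hLd (by positivity)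
    _ = _ := by ring

lemma srwP_eq (hreg : ∀ x, dout E x = d) (x y : V) :
    srwP E x y = if E x y then (d : ℝ)⁻¹ else 0 := by
  rw [srwP, hreg, one_div]

lemma srwP_mem_doublyStochastic (hd : 1 ≤ d) (hreg : ∀ x, dout E x = d ∧ din E x = d) :
    srwP E ∈ doublyStochastic ℝ V := by
  have hd0 : (d : ℝ) ≠ 0 := by positivity
  have hP := srwP_eq fun x => (hreg x).1
  rw [mem_doublyStochastic_iff_sum]
  refine ⟨fun x y => ?_, fun x => ?_, fun y => ?_⟩
  · rw [hP]
    split_ifs <;> positivity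
  · simp only [hP, ← Finset.sum_filter, Finset.sum_const, nsmul_eq_mul]
    rw [← dout, (hreg x).1, mul_inv_cancel₀ hd0]
  · simp only [hP, ← Finset.sum_filter, Finset.sum_const, nsmul_eq_mul]
    rw [← din, (hreg y).2, mul_inv_cancel₀ hd0]

lemma energy_srwP (hreg : ∀ x, dout E x = d) (f : V → ℝ) :
    energy (srwP E) f = edgeEnergy E f / (2 * d) := by
  have h : ∀ x y, srwP E x y * (f x - f y) ^ 2
      = (d : ℝ)⁻¹ * if E x y then (f x - f y) ^ 2 else 0 := fun x y => by
    rw [srwP_eq hreg]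
    split_ifs <;> simp
  simp only [energy, edgeEnergy, h, ← Finset.mul_sum]
  rw [div_eq_mul_inv, div_eq_mul_inv, mul_inv]
  ring

/-- The diagonal of the resolvent killed at rate `1 / (1280 k ^ 2)` is `O(k)`. -/
lemma IsResolvent.two_mul_mul_self_le (hd : 1 ≤ d) (hreg : ∀ x, dout E x = d ∧ din E x = d)
    (hconn : (SimpleGraph.fromRel E).Connected) {k : ℕ} (hk : 1 ≤ k)
    (hkn : 4 * k ≤ Fintype.card V) {s : ℝ} (hs : s = 1280 * (k : ℝ) ^ 2) {g : V → V → ℝ}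
    (hg : IsResolvent (srwP E) (1 - s⁻¹) g) (a : V) : 2 * (k * g a a) ≤ s := by
  have hP := srwP_mem_doublyStochastic hd hreg
  have hk1 : (1 : ℝ) ≤ k := by exact_mod_cast hk
  have hd1 : (1 : ℝ) ≤ d := by exact_mod_cast hd
  have hs2 : 1280 * (k : ℝ) ≤ s := by rw [hs]; nlinarith
  have hs0 : 0 < s := by linarith
  have hinv : s⁻¹ ≤ 1 / 2 := by
    rw [one_div]
    exact inv_anti₀ two_pos (by linarith)
  have hr0 : 0 ≤ 1 - s⁻¹ := by linarith
  have hr1 : 1 - s⁻¹ < 1 := sub_lt_self _ (inv_pos.2 hs0)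
  have hg0 := hg.nonneg hP hr0 hr1
  set M := g a a with hM
  have hM0 : 0 ≤ M := hg0 a a
  have hen0 := energy_nonneg hP (g a)
  have hen : energy (srwP E) (g a) ≤ 2 * M := by
    have := hg.mul_energy_le hP hr1 a
    nlinarith
  have hedge : edgeEnergy E (g a) = 2 * d * energy (srwP E) (g a) := by
    rw [energy_srwP fun x => (hreg x).1]
    field_simp
  have hsum : ∑ x, g a x = s := by
    have := hg.sum_eq hP a
    rw [sub_sub_cancel] at this
    field_simp at this
    exact this
  rcases hM0.eq_or_lt with hM00 | hMpos
  · rw [← hM00]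
    simpa using hs0.le
  let S : Finset V := Finset.univ.filter fun x => M / 2 < g a x
  have hmem : ∀ x, x ∈ S ↔ M / 2 < g a x := fun x => by simp [S]
  have hS : S.card * (M / 2) ≤ s := by
    calc S.card * (M / 2) = ∑ x ∈ S, M / 2 := by simp
      _ ≤ ∑ x ∈ S, g a x := Finset.sum_le_sum fun x hx => ((hmem x).1 hx).le
      _ ≤ ∑ x, g a x := Finset.sum_le_sum_of_subset_of_nonneg (Finset.subset_univ _)
          fun x _ _ => hg0 a x
      _ = s := hsum
  by_cases hSu : S = Finset.univ
  · rw [hSu, Finset.card_univ] at hS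
    have : (4 : ℝ) * k ≤ Fintype.card V := by exact_mod_cast hkn
    nlinarith
  have hgap : ∀ x ∉ S, (M / 2) ^ 2 ≤ (M - g a x) ^ 2 := fun x hx => by
    rw [hmem, not_lt] at hx
    exact pow_le_pow_left₀ (by positivity) (by linarith) 2
  by_cases hSd : 2 * S.card ≤ d
  · have hcard : d ≤ 2 * ((Finset.univ.filter fun y => E a y) \ S).card := by
      have h1 := Finset.le_card_sdiff S (Finset.univ.filter fun y => E a y)
      rw [← dout, (hreg a).1] at h1
      omega
    have hcard' : (d : ℝ) ≤ 2 * ((Finset.univ.filter fun y => E a y) \ S).card := by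
      exact_mod_cast hcard
    have hterm : ∀ x y, 0 ≤ if E x y then (g a x - g a y) ^ 2 else 0 := fun x y => by
      split_ifs <;> positivity
    have hlow : ((Finset.univ.filter fun y => E a y) \ S).card * (M / 2) ^ 2
        ≤ edgeEnergy E (g a) := by
      calc ((Finset.univ.filter fun y => E a y) \ S).card * (M / 2) ^ 2
          = ∑ y ∈ (Finset.univ.filter fun y => E a y) \ S, (M / 2) ^ 2 := by simp
        _ ≤ ∑ y ∈ (Finset.univ.filter fun y => E a y) \ S,
            (if E a y then (g a a - g a y) ^ 2 else 0) := Finset.sum_le_sum fun y hy => by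
            rw [Finset.mem_sdiff, Finset.mem_filter] at hy
            rw [if_pos hy.1.2]
            exact hgap y hy.2
        _ ≤ ∑ y, (if E a y then (g a a - g a y) ^ 2 else 0) :=
            Finset.sum_le_sum_of_subset_of_nonneg (Finset.subset_univ _) fun y _ _ => hterm a y
        _ ≤ edgeEnergy E (g a) := Finset.single_le_sum
            (f := fun x => ∑ y, if E x y then (g a x - g a y) ^ 2 else 0)
            (fun x _ => Finset.sum_nonneg fun y _ => hterm x y) (Finset.mem_univ a)
    have h1 : (d : ℝ) * (M * M) ≤ d * (32 * M) := by
      have h2 : (d : ℝ) * energy (srwP E) (g a) ≤ d * (2 * M) :=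
        mul_le_mul_of_nonneg_left hen (by positivity)
      nlinarith [mul_le_mul_of_nonneg_right hcard' (sq_nonneg (M / 2))]
    have h3 : M ≤ 32 :=
      le_of_mul_le_mul_right (le_of_mul_le_mul_left h1 (by linarith)) hMpos
    nlinarith
  · push Not at hSd
    have hSd' : (d : ℝ) ≤ 2 * S.card := by exact_mod_cast hSd.le
    obtain ⟨y, hy, hle⟩ := exists_notMem_sq_sub_le (fun x => (hreg x).1) hconn hSu a (g a)
    have h1 : (d : ℝ) * (M / 2) ^ 2 ≤ d * (20 * S.card * (2 * M)) := by
      calc (d : ℝ) * (M / 2) ^ 2 ≤ d * (M - g a y) ^ 2 :=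
            mul_le_mul_of_nonneg_left (hgap y hy) (by positivity)
        _ ≤ 2 * (3 * S.card + d) * (2 * d * energy (srwP E) (g a)) := hedge ▸ hle
        _ ≤ 2 * (3 * S.card + 2 * S.card) * (2 * d * (2 * M)) := by gcongr
        _ = d * (20 * S.card * (2 * M)) := by ring
    have h2 : (M / 2) ^ 2 ≤ 20 * S.card * (2 * M) := le_of_mul_le_mul_left h1 (by linarith)
    have h3 : M ^ 2 ≤ (640 * k) ^ 2 := by
      rw [hs] at hS
      nlinarith
    have h4 : M ≤ 640 * k := le_of_sq_le_sq h3 (by positivity)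
    rw [hs]
    nlinarith

lemma sum_surviveFrom_le_of_four_mul_le (hd : 1 ≤ d)
    (hreg : ∀ x, dout E x = d ∧ din E x = d) (hconn : (SimpleGraph.fromRel E).Connected) {k : ℕ}
    (hk : 1 ≤ k) (hkn : 4 * k ≤ Fintype.card V) (v : V) (T : ℕ) :
    ∑ t ∈ Finset.range T, surviveFrom (srwP E) k t ∅ v ≤ 1280 * (k : ℝ) ^ 2 := by
  have hP := srwP_mem_doublyStochastic hd hreg
  have hk1 : (1 : ℝ) ≤ k := by exact_mod_cast hk
  set s := 1280 * (k : ℝ) ^ 2 with hs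
  have hs1 : 1 ≤ s := by rw [hs]; nlinarith
  obtain ⟨g, hg⟩ := exists_isResolvent hP (r := 1 - s⁻¹)
    (sub_nonneg.2 (inv_le_one_of_one_le₀ hs1)) (sub_lt_self _ (inv_pos.2 (by linarith)))
  refine sum_surviveFrom_le_of_isResolvent hP hs1 hg (G := s / (2 * k)) (fun a => ?_) ?_ hk v T
  · rw [le_div_iff₀ (by linarith)]
    linarith [hg.two_mul_mul_self_le hd hreg hconn hk hkn hs a]
  · refine le_of_eq ?_
    field_simp

/-- The cover time of a connected regular digraph is at most `8 n ^ 2`. -/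
lemma sum_surviveFrom_le_card_sq (hd : 1 ≤ d)
    (hreg : ∀ x, dout E x = d ∧ din E x = d) (hconn : (SimpleGraph.fromRel E).Connected) {k : ℕ}
    (hk : k ≤ Fintype.card V) (v : V) (T : ℕ) :
    ∑ t ∈ Finset.range T, surviveFrom (srwP E) k t ∅ v ≤ 8 * (Fintype.card V : ℝ) ^ 2 := by
  have hd0 : (0 : ℝ) < d := by exact_mod_cast hd
  have hP := srwP_mem_doublyStochastic hd hreg
  have hPE := srwP_eq fun x => (hreg x).1
  have hP0 : ∀ x y, 0 ≤ srwP E x y := fun x y => nonneg_of_mem_doublyStochastic hP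
  let Q : Matrix V V ℝ := fun x y => (srwP E x y + srwP E y x) / 2
  have hPQ : ∀ x y, Q x y = (srwP E x y + srwP E y x) / 2 := fun _ _ => rfl
  have hQS : ∀ x y, Q x y = Q y x := fun x y => by rw [hPQ, hPQ, add_comm]
  have hQrow : ∀ x, ∑ y, Q x y = 1 := fun x => by
    simp only [hPQ]
    rw [← Finset.sum_div, Finset.sum_add_distrib, sum_row_of_mem_doublyStochastic hP,
      sum_col_of_mem_doublyStochastic hP]
    norm_num
  have hQ : Q ∈ doublyStochastic ℝ V := by
    rw [mem_doublyStochastic_iff_sum]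
    refine ⟨fun x y => ?_, hQrow, fun y => ?_⟩
    · have := hP0 x y
      have := hP0 y x
      rw [hPQ]
      linarith
    · rw [Finset.sum_congr rfl fun x _ => hQS x y, hQrow]
  have hPpos : ∀ x y, E x y → 0 < srwP E x y := fun x y h => by
    rw [hPE, if_pos h]
    positivity
  have hQlow : ∀ x y, E x y → (2 * (d : ℝ))⁻¹ ≤ Q x y := fun x y h => by
    have := hP0 y x
    rw [hPQ, hPE x y, if_pos h, mul_inv]
    linarith
  have hPup : ∀ x y, d * srwP E x y ≤ 1 := fun x y => by
    rw [hPE]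
    split_ifs
    · rw [mul_inv_cancel₀ hd0.ne']
    · simp
  have hQE : EnergyDefinite Q := energyDefinite_of_connected hconn hQ fun x y h =>
    lt_of_lt_of_le (by positivity) (hQlow x y h)
  obtain ⟨u, hu⟩ := exists_isPotentialKernel hP (energyDefinite_of_connected hconn hP hPpos)
  obtain ⟨κ, hκ⟩ := exists_isPotentialKernel hQ hQE
  have hedge : ∀ x y, E x y → kernelResistance κ x y ≤ 2 * d := fun x y h => by
    by_contra! hlt
    have h1 := mul_kernelResistance_le_one hQ hQS hκ x y
    have h2 : (2 * (d : ℝ))⁻¹ * (2 * d) < Q x y * kernelResistance κ x y :=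
      mul_lt_mul' (hQlow x y h) hlt (by positivity) (lt_of_lt_of_le (by positivity) (hQlow x y h))
    rw [inv_mul_cancel₀ (by positivity)] at h2
    linarith
  have hcross : ∀ B : Finset V, B.Nonempty → B ≠ Finset.univ →
      ∃ x ∈ B, ∃ y ∉ B, kernelResistance κ x y ≤ 2 * d := by
    rintro B ⟨b, hb⟩ hB
    obtain ⟨z, hz⟩ : ∃ z, z ∉ B := by
      by_contra! h
      exact hB (Finset.eq_univ_iff_forall.2 h)
    obtain ⟨p⟩ := hconn.preconnected b z
    obtain ⟨e, -, h1, h2⟩ := p.exists_boundary_dart (B : Set V) hb hz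
    refine ⟨e.fst, h1, e.snd, h2, ?_⟩
    have h3 := e.adj
    rw [SimpleGraph.fromRel_adj] at h3
    rcases h3.2 with h | h
    · exact hedge _ _ h
    · rw [kernelResistance_comm]
      exact hedge _ _ h
  obtain ⟨l, Z, hl, hZ, hcost⟩ := exists_tour (H := kernelHit u) (N := Fintype.card V)
    (Nat.cast_nonneg _) (kernelResistance_comm κ) (fun x y => by
      rw [kernelHit_add_kernelHit]
      exact mul_le_mul_of_nonneg_left
        (kernelResistance_le_of_symmetrization hP hQ hPQ hu hκ x y) (Nat.cast_nonneg _))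
    hcross (by positivity) v
  have hZcard := card_mul_le_of_resistance_separated hQ hQS hQE (d := d) (fun x y => by
    have := hPup x y
    have := hPup y x
    rw [hPQ]
    linarith) hd0.le hκ hZ
  calc ∑ t ∈ Finset.range T, surviveFrom (srwP E) k t ∅ v ≤ tourCost (kernelHit u) v l :=
        sum_surviveFrom_le_tourCost hP (kernelHit_nonneg hP hu) (fun x => by simp [kernelHit])
          (fun x y hxy => (one_add_sum_kernelHit hP hu hxy).le) hk hl T
    _ ≤ Fintype.card V * (4 * Fintype.card V + 2 * d * Z.card) := hcost
    _ ≤ Fintype.card V * (4 * Fintype.card V + 2 * (2 * Fintype.card V)) := by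
        rw [mul_assoc]
        gcongr
    _ = 8 * (Fintype.card V : ℝ) ^ 2 := by ring

end RegularDigraph

/-- There is a positive constant `c1` such that for every connected
`d`-regular Eulerian digraph on `n` vertices, every starting vertex `v` and every `1 ≤ k ≤ n`,
the simple random walk satisfies `E_v[T_k] ≤ c1·k²` (expressed via
`E_v[T_k] = ∑_{t≥0} P_v(T_k > t)`, bounded through all its partial sums). -/
theorem regular_eulerian_exploration_time :
    ∃ c1 : ℝ, 0 < c1 ∧
      ∀ (V : Type) [Fintype V] [DecidableEq V] (E : V → V → Prop) [DecidableRel E] (d : ℕ),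
        (∀ x, ¬ E x x) →
        (∀ x, dout E x = d ∧ din E x = d) →
        (SimpleGraph.fromRel E).Connected →
        ∀ (v : V) (k : ℕ), 1 ≤ k → k ≤ Fintype.card V →
          ∀ T : ℕ, ∑ t ∈ Finset.range T, exploreSurv (srwP E) v k t ≤ c1 * (k : ℝ) ^ 2 := by
  refine ⟨1280, by norm_num, ?_⟩
  intro V _ _ E _ d _ hreg hconn v k hk hkn T
  simp only [exploreSurv_eq_surviveFrom]
  rcases hk.eq_or_lt with rfl | hk2
  · rw [Finset.sum_eq_zero fun t _ => surviveFrom_eq_zero _ t (by simp)]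
    norm_num
  have hd : 1 ≤ d := by
    by_contra! hd0
    have : Nontrivial V := Fintype.one_lt_card_iff_nontrivial.1 (by omega)
    obtain ⟨w, hw⟩ := hconn.preconnected.exists_adj_of_nontrivial v
    rw [SimpleGraph.fromRel_adj] at hw
    have hnot : ∀ x y, ¬ E x y := fun x y h => by
      have h1 : 0 < dout E x := Finset.card_pos.2 ⟨y, by simpa using h⟩
      have := (hreg x).1
      omega
    exact hw.2.elim (hnot v w) (hnot w v)
  rcases le_or_gt (4 * k) (Fintype.card V) with h4 | h4
  · exact sum_surviveFrom_le_of_four_mul_le hd hreg hconn hk h4 v T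
  · have h5 : (Fintype.card V : ℝ) ≤ 4 * k := by exact_mod_cast h4.le
    have h6 := sum_surviveFrom_le_card_sq hd hreg hconn hkn v T
    nlinarith [pow_le_pow_left₀ (Nat.cast_nonneg (Fintype.card V)) h5 2]
end

section
/- Let G be a connected Eulerian digraph with m directed edges, and let v and w be two vertices whose distance in the underlying undirected graph equals ℓ. Then the commute time of the simple random walk on G between v and w satisfies C(v,w) = E_v[τ_{{w}}] + E_w[τ_{{v}}] ≤ m·ℓ. -/
open Finset

/-- The substochastic matrix `Q` of the chain `P` killed on the set `A`:
`Q(x,y) = P(x,y)` if `x ∉ A` and `y ∉ A`, and `Q(x,y) = 0` otherwise. -/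
noncomputable def hitQ {V : Type} [Fintype V] [DecidableEq V] (P : Matrix V V ℝ)
    (A : Finset V) : Matrix V V ℝ :=
  fun x y => if x ∉ A ∧ y ∉ A then P x y else 0

/-- The partial sums `∑_{t<T} ∑_{w∉A} Q^t(v,w)` of the series defining the expected hitting
time `E_v[τ_A] = ∑_{t=0}^∞ ∑_{w∉A} Q^t(v,w)`. -/
noncomputable def hitTimePartial {V : Type} [Fintype V] [DecidableEq V] (P : Matrix V V ℝ)
    (A : Finset V) (v : V) (T : ℕ) : ℝ :=
  ∑ t ∈ Finset.range T, ∑ w ∈ Finset.univ.filter (fun w => w ∉ A), (hitQ P A ^ t) v w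

section HittingTime

variable {V : Type} [Fintype V] [DecidableEq V] {P : Matrix V V ℝ} {A : Finset V}

theorem hitTimePartial_zero (x : V) : hitTimePartial P A x 0 = 0 := by
  simp [hitTimePartial]

theorem hitTimePartial_of_mem {x : V} (hx : x ∈ A) (T : ℕ) : hitTimePartial P A x T = 0 := by
  unfold hitTimePartial
  refine Finset.sum_eq_zero fun t _ => Finset.sum_eq_zero fun y hy => ?_
  have hy' : y ∉ A := (Finset.mem_filter.1 hy).2
  cases t with
  | zero => exact Matrix.one_apply_ne (fun h => hy' (h ▸ hx))
  | succ t =>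
    rw [pow_succ', Matrix.mul_apply]
    exact Finset.sum_eq_zero fun z _ => by simp [hitQ, hx]

/-- First-step decomposition of the truncated hitting time. -/
theorem hitTimePartial_succ {x : V} (hx : x ∉ A) (T : ℕ) :
    hitTimePartial P A x (T + 1) = 1 + ∑ y, P x y * hitTimePartial P A y T := by
  have step : ∀ y, P x y * hitTimePartial P A y T = hitQ P A x y * hitTimePartial P A y T := by
    intro y
    by_cases hy : y ∈ A
    · simp [hitTimePartial_of_mem hy]
    · simp [hitQ, hx, hy]
  rw [Finset.sum_congr rfl fun y _ => step y]
  unfold hitTimePartial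
  rw [Finset.sum_range_succ', add_comm]
  congr 1
  · simp [Matrix.one_apply, hx]
  · simp only [Finset.mul_sum, pow_succ', Matrix.mul_apply]
    rw [Finset.sum_comm (s := Finset.univ)]
    exact Finset.sum_congr rfl fun t _ => Finset.sum_comm

theorem hitTimePartial_nonneg (hP : ∀ x y, 0 ≤ P x y) (T : ℕ) (x : V) :
    0 ≤ hitTimePartial P A x T := by
  induction T generalizing x with
  | zero => simp [hitTimePartial_zero]
  | succ T ih =>
    by_cases hx : x ∈ A
    · rw [hitTimePartial_of_mem hx]
    · rw [hitTimePartial_succ hx]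
      have := Finset.sum_nonneg fun y (_ : y ∈ Finset.univ) => mul_nonneg (hP x y) (ih y)
      linarith

theorem hitTimePartial_mono (hP : ∀ x y, 0 ≤ P x y) (x : V) :
    Monotone (hitTimePartial P A x) := by
  refine monotone_nat_of_le_succ fun T => ?_
  induction T generalizing x with
  | zero => rw [hitTimePartial_zero]; exact hitTimePartial_nonneg hP _ _
  | succ T ih =>
    by_cases hx : x ∈ A
    · simp [hitTimePartial_of_mem hx]
    · rw [hitTimePartial_succ hx, hitTimePartial_succ hx]
      gcongr with y
      · exact hP x y
      · exact ih y

/-- Truncated hitting times lie below every nonnegative supersolution of the first-step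
equations. -/
theorem hitTimePartial_le_of_supersolution (hP : ∀ x y, 0 ≤ P x y) {g : V → ℝ}
    (hg : ∀ x, 0 ≤ g x) (hsup : ∀ x, x ∉ A → 1 + ∑ y, P x y * g y ≤ g x) (T : ℕ) (x : V) :
    hitTimePartial P A x T ≤ g x := by
  induction T generalizing x with
  | zero => rw [hitTimePartial_zero]; exact hg x
  | succ T ih =>
    by_cases hx : x ∈ A
    · rw [hitTimePartial_of_mem hx]; exact hg x
    · rw [hitTimePartial_succ hx]
      refine le_trans ?_ (hsup x hx)
      gcongr with y
      · exact hP x y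
      · exact ih y

theorem hitTimePartial_triangle (hP : ∀ x y, 0 ≤ P x y) (hP1 : ∀ x, ∑ y, P x y ≤ 1)
    (u w : V) (T : ℕ) (x : V) :
    hitTimePartial P {w} x T ≤ hitTimePartial P {u} x T + hitTimePartial P {w} u T := by
  induction T generalizing x with
  | zero => simp [hitTimePartial_zero]
  | succ T ih =>
    by_cases hw : x = w
    · rw [hitTimePartial_of_mem (by simp [hw])]
      exact add_nonneg (hitTimePartial_nonneg hP _ _) (hitTimePartial_nonneg hP _ _)
    by_cases hu : x = u
    · subst hu
      rw [hitTimePartial_of_mem (A := {x}) (by simp)]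
      simp
    have hmono : hitTimePartial P {w} u T ≤ hitTimePartial P {w} u (T + 1) :=
      hitTimePartial_mono hP u (Nat.le_succ T)
    rw [hitTimePartial_succ (by simpa using hw), hitTimePartial_succ (A := {u}) (by simpa using hu)]
    have h1 : ∑ y, P x y * hitTimePartial P {w} y T ≤
        ∑ y, P x y * (hitTimePartial P {u} y T + hitTimePartial P {w} u T) := by
      gcongr with y
      · exact hP x y
      · exact ih y
    have h2 := mul_le_mul_of_nonneg_right (hP1 x) (hitTimePartial_nonneg (A := {w}) hP T u)
    simp only [mul_add, Finset.sum_add_distrib, ← Finset.sum_mul] at h1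
    linarith

end HittingTime

section Degree

variable {V : Type} [Fintype V] {E : V → V → Prop} [DecidableRel E]

theorem dout_pos_of_edge {x y : V} (h : E x y) : 0 < dout E x :=
  Finset.card_pos.2 ⟨y, by simpa using h⟩

/-- In an Eulerian digraph, a vertex set with no edge leaving it has no edge entering it. -/
theorem inClosed_of_outClosed (heul : ∀ x, dout E x = din E x) (B : Set V)
    (hB : ∀ x y, E x y → x ∈ B → y ∈ B) (x y : V) (hxy : E x y) (hy : y ∈ B) : x ∈ B := by
  classical
  by_contra hx
  have hout : ∑ a with a ∈ B, dout E a = ∑ b with b ∈ B, ((univ.filter (· ∈ B)).filter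
      fun a => E a b).card := by
    have : ∀ a ∈ univ.filter (· ∈ B), dout E a = ((univ.filter (· ∈ B)).filter
        fun b => E a b).card := by
      intro a ha
      unfold dout
      congr 1
      ext b
      simp only [mem_filter, mem_univ, true_and] at ha ⊢
      exact ⟨fun h => ⟨hB a b h ha, h⟩, And.right⟩
    rw [Finset.sum_congr rfl this]
    exact Finset.sum_card_bipartiteAbove_eq_sum_card_bipartiteBelow E
  have hlt : ∑ b with b ∈ B, ((univ.filter (· ∈ B)).filter fun a => E a b).card <
      ∑ b with b ∈ B, din E b := by
    refine Finset.sum_lt_sum (fun b _ => ?_) ⟨y, by simpa using hy, ?_⟩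
    · exact Finset.card_le_card (Finset.filter_subset_filter _ (Finset.subset_univ _))
    · refine Finset.card_lt_card ⟨Finset.filter_subset_filter _ (Finset.subset_univ _), ?_⟩
      intro h
      have := h (by simpa using hxy : x ∈ univ.filter fun a => E a y)
      simp [hx] at this
  rw [← hout, Finset.sum_congr rfl fun b _ => heul b] at hlt
  exact lt_irrefl _ hlt

end Degree

section EulerianWalk

variable {V : Type} [Fintype V] [DecidableEq V] {E : V → V → Prop} [DecidableRel E]

theorem srwP_nonneg (x y : V) : 0 ≤ srwP E x y := by
  unfold srwP; split_ifs <;> positivity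

theorem dout_mul_srwP (x y : V) : (dout E x : ℝ) * srwP E x y = if E x y then 1 else 0 := by
  unfold srwP
  split_ifs with h
  · have : (dout E x : ℝ) ≠ 0 := by exact_mod_cast (dout_pos_of_edge h).ne'
    field_simp
  · simp

theorem srwP_row_sum_le (x : V) : ∑ y, srwP E x y ≤ 1 := by
  have h : ∑ y, srwP E x y = (dout E x : ℝ) * (1 / (dout E x : ℝ)) := by
    simp [srwP, ← Finset.sum_filter, dout]
  rw [h, mul_one_div]
  exact div_self_le_one _

/-- On an Eulerian digraph the degree measure is stationary for the simple random walk. -/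
theorem sum_dout_mul_srwP (heul : ∀ x, dout E x = din E x) (f : V → ℝ) :
    ∑ x, (dout E x : ℝ) * ∑ y, srwP E x y * f y = ∑ y, (dout E y : ℝ) * f y := by
  simp only [Finset.mul_sum, ← mul_assoc, dout_mul_srwP]
  rw [Finset.sum_comm]
  refine Finset.sum_congr rfl fun y _ => ?_
  rw [← Finset.sum_mul, heul y]
  simp [din]

/-- Integrating the first-step equations against the stationary degree measure. -/
theorem sum_dout_mul_firstStep (heul : ∀ x, dout E x = din E x) (v : V) {f g : V → ℝ}
    (hv : g v = 0) (hfg : ∀ x, x ≠ v → g x = 1 + ∑ y, srwP E x y * f y) :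
    ∑ x, (dout E x : ℝ) * g x + dout E v * (1 + ∑ y, srwP E v y * f y) =
      numEdges E + ∑ x, (dout E x : ℝ) * f x := by
  have h : ∀ x, (dout E x : ℝ) * g x = dout E x + dout E x * ∑ y, srwP E x y * f y -
      if x = v then (dout E v : ℝ) * (1 + ∑ y, srwP E v y * f y) else 0 := by
    intro x
    split_ifs with hx
    · subst hx; rw [hv]; ring
    · rw [hfg x hx]; ring
  simp only [h, Finset.sum_sub_distrib, Finset.sum_add_distrib, sum_dout_mul_srwP heul,
    Finset.sum_ite_eq', Finset.mem_univ, if_true, numEdges, Nat.cast_sum]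
  ring

/-- The truncated form of Kac's formula. -/
theorem dout_mul_returnTime_le (heul : ∀ x, dout E x = din E x) (v : V) (T : ℕ) :
    (dout E v : ℝ) * (1 + ∑ y, srwP E v y * hitTimePartial (srwP E) {v} y T) ≤ numEdges E := by
  have h := sum_dout_mul_firstStep heul v (f := fun y => hitTimePartial (srwP E) {v} y T)
    (g := fun y => hitTimePartial (srwP E) {v} y (T + 1)) (hitTimePartial_of_mem (by simp) _)
    (fun x hx => hitTimePartial_succ (by simpa using hx) T)
  have hm : ∑ x, (dout E x : ℝ) * hitTimePartial (srwP E) {v} x T ≤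
      ∑ x, (dout E x : ℝ) * hitTimePartial (srwP E) {v} x (T + 1) := by
    gcongr with x
    exact hitTimePartial_mono srwP_nonneg x (Nat.le_succ T)
  linarith

theorem bddAbove_of_firstStep_le {v x y : V} (hxy : E x y) {C : ℝ}
    (h : ∀ T, 1 + ∑ z, srwP E x z * hitTimePartial (srwP E) {v} z T ≤ C) :
    BddAbove (Set.range (hitTimePartial (srwP E) {v} y)) := by
  refine ⟨dout E x * C, ?_⟩
  rintro _ ⟨T, rfl⟩
  have hone : (dout E x : ℝ) * srwP E x y = 1 := by simp [dout_mul_srwP, hxy]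
  have hle : srwP E x y * hitTimePartial (srwP E) {v} y T ≤
      ∑ z, srwP E x z * hitTimePartial (srwP E) {v} z T :=
    Finset.single_le_sum (f := fun z => srwP E x z * hitTimePartial (srwP E) {v} z T)
      (fun z _ => mul_nonneg (srwP_nonneg x z) (hitTimePartial_nonneg srwP_nonneg T z))
      (Finset.mem_univ y)
  calc hitTimePartial (srwP E) {v} y T
      = dout E x * (srwP E x y * hitTimePartial (srwP E) {v} y T) := by
        rw [← mul_assoc, hone, one_mul]
    _ ≤ dout E x * C := by
        gcongr
        linarith [h T]

/-- Hitting times in a connected Eulerian digraph are finite. -/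
theorem hitTimePartial_bddAbove (heul : ∀ x, dout E x = din E x)
    (hconn : (SimpleGraph.fromRel E).Connected) (v x : V) :
    BddAbove (Set.range (hitTimePartial (srwP E) {v} x)) := by
  set B : Set V := {x | BddAbove (Set.range (hitTimePartial (srwP E) {v} x))} with hBdef
  have hout : ∀ x y, E x y → x ∈ B → y ∈ B := by
    intro x y hxy hx
    by_cases hxv : x = v
    · subst hxv
      have hd : (0 : ℝ) < dout E x := by exact_mod_cast dout_pos_of_edge hxy
      refine bddAbove_of_firstStep_le hxy (C := numEdges E / dout E x) fun T => ?_
      rw [le_div_iff₀ hd, mul_comm]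
      exact dout_mul_returnTime_le heul x T
    · obtain ⟨C, hC⟩ := hx
      refine bddAbove_of_firstStep_le hxy (C := C) fun T => ?_
      rw [← hitTimePartial_succ (by simpa using hxv)]
      exact hC ⟨T + 1, rfl⟩
  have hin := inClosed_of_outClosed heul B hout
  have hvB : v ∈ B := ⟨0, by rintro _ ⟨T, rfl⟩; rw [hitTimePartial_of_mem (by simp)]⟩
  obtain ⟨p⟩ := hconn.preconnected x v
  change x ∈ B
  induction p with
  | nil => exact hvB
  | cons h _ ih =>
    have hmem := ih hBdef hout hin hvB
    rcases h.2 with h | h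
    · exact hin _ _ h hmem
    · exact hout _ _ h hmem

open Filter Topology in
/-- The expected hitting times of `v` solve the first-step equations and satisfy Kac's formula. -/
theorem exists_hittingTime (heul : ∀ x, dout E x = din E x)
    (hconn : (SimpleGraph.fromRel E).Connected) (v : V) :
    ∃ h : V → ℝ, (∀ T x, hitTimePartial (srwP E) {v} x T ≤ h x) ∧ h v = 0 ∧
      (∀ x, x ≠ v → h x = 1 + ∑ y, srwP E x y * h y) ∧
      (dout E v : ℝ) * (1 + ∑ y, srwP E v y * h y) = numEdges E := by
  have hlim : ∀ x, Tendsto (hitTimePartial (srwP E) {v} x) atTop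
      (𝓝 (⨆ T, hitTimePartial (srwP E) {v} x T)) := fun x =>
    tendsto_atTop_ciSup (hitTimePartial_mono srwP_nonneg x) (hitTimePartial_bddAbove heul hconn v x)
  set h : V → ℝ := fun x => ⨆ T, hitTimePartial (srwP E) {v} x T
  have hv : h v = 0 := by simp [h, hitTimePartial_of_mem]
  have hstep : ∀ x, x ≠ v → h x = 1 + ∑ y, srwP E x y * h y := by
    intro x hx
    refine tendsto_nhds_unique ((tendsto_add_atTop_iff_nat 1).2 (hlim x)) ?_
    simp only [hitTimePartial_succ (show x ∉ ({v} : Finset V) by simpa using hx)]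
    exact tendsto_const_nhds.add (tendsto_finsetSum _ fun y _ => (hlim y).const_mul _)
  refine ⟨h, fun T x => le_ciSup (hitTimePartial_bddAbove heul hconn v x) T, hv, hstep, ?_⟩
  have := sum_dout_mul_firstStep heul v hv hstep
  linarith

/-- The commute time between the endpoints of an edge is at most the number of edges. -/
theorem commute_le_of_edge (heul : ∀ x, dout E x = din E x)
    (hconn : (SimpleGraph.fromRel E).Connected) {v w : V} (hvw : E v w) (T : ℕ) :
    hitTimePartial (srwP E) {w} v T + hitTimePartial (srwP E) {v} w T ≤ numEdges E := by
  obtain ⟨h, hle, hv, hstep, hkac⟩ := exists_hittingTime heul hconn v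
  have hnn : ∀ x, 0 ≤ h x := fun x => (hitTimePartial_nonneg srwP_nonneg 0 x).trans (hle 0 x)
  have hone : (dout E v : ℝ) * srwP E v w = 1 := by simp [dout_mul_srwP, hvw]
  have hd : (0 : ℝ) < dout E v := by exact_mod_cast dout_pos_of_edge hvw
  set c : ℝ := numEdges E - h w with hc
  have hc0 : 0 ≤ c := by
    have hsingle : srwP E v w * h w ≤ ∑ y, srwP E v y * h y :=
      Finset.single_le_sum (f := fun y => srwP E v y * h y)
        (fun y _ => mul_nonneg (srwP_nonneg v y) (hnn y)) (Finset.mem_univ w)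
    have : h w ≤ numEdges E := by
      calc h w = dout E v * (srwP E v w * h w) := by rw [← mul_assoc, hone, one_mul]
        _ ≤ dout E v * (1 + ∑ y, srwP E v y * h y) := by gcongr; linarith
        _ = numEdges E := hkac
    linarith
  -- `g` is the expected time to traverse the edge `(v, w)`, set to zero at `w`.
  set g : V → ℝ := fun x => if x = w then 0 else h x + c with hg
  have hg0 : ∀ x, 0 ≤ g x := by
    intro x
    simp only [hg]
    split_ifs
    · exact le_rfl
    · exact add_nonneg (hnn x) hc0
  have hsum : ∀ x, ∑ y, srwP E x y * g y =
      ∑ y, srwP E x y * h y + (∑ y, srwP E x y) * c - srwP E x w * numEdges E := by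
    intro x
    have : ∀ y, srwP E x y * g y = srwP E x y * h y + srwP E x y * c -
        if y = w then srwP E x w * numEdges E else 0 := by
      intro y
      simp only [hg]
      split_ifs with hy
      · subst hy; rw [hc]; ring
      · ring
    simp only [this, Finset.sum_sub_distrib, Finset.sum_add_distrib, ← Finset.sum_mul,
      Finset.sum_ite_eq', Finset.mem_univ, if_true]
  have hsup : ∀ x, x ∉ ({w} : Finset V) → 1 + ∑ y, srwP E x y * g y ≤ g x := by
    intro x hx
    have hxw : x ≠ w := by simpa using hx
    have hrow := mul_le_mul_of_nonneg_right (srwP_row_sum_le (E := E) x) hc0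
    have hgx : g x = h x + c := by simp [hg, hxw]
    rw [hsum, hgx]
    by_cases hxv : x = v
    · subst hxv
      have : 1 + ∑ y, srwP E x y * h y = srwP E x w * numEdges E := by
        rw [← hkac, ← mul_assoc, mul_comm (srwP E x w), hone, one_mul]
      linarith
    · have := mul_nonneg (srwP_nonneg (E := E) x w) (Nat.cast_nonneg (α := ℝ) (numEdges E))
      linarith [hstep x hxv]
  have hgv : g v ≤ c := by
    simp only [hg]
    split_ifs
    · exact hc0
    · rw [hv, zero_add]
  linarith [hitTimePartial_le_of_supersolution srwP_nonneg hg0 hsup T v, hle T w]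

theorem commute_le_of_walk (heul : ∀ x, dout E x = din E x)
    (hconn : (SimpleGraph.fromRel E).Connected) {v w : V}
    (p : (SimpleGraph.fromRel E).Walk v w) (T : ℕ) :
    hitTimePartial (srwP E) {w} v T + hitTimePartial (srwP E) {v} w T ≤
      (numEdges E : ℝ) * p.length := by
  induction p with
  | nil => simp [hitTimePartial_of_mem]
  | @cons a u b h p ih =>
    have hadj : hitTimePartial (srwP E) {u} a T + hitTimePartial (srwP E) {a} u T ≤ numEdges E := by
      rcases h.2 with h | h
      · exact commute_le_of_edge heul hconn h T
      · rw [add_comm]; exact commute_le_of_edge heul hconn h T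
    have h1 := hitTimePartial_triangle (srwP_nonneg (E := E)) srwP_row_sum_le u b T a
    have h2 := hitTimePartial_triangle (srwP_nonneg (E := E)) srwP_row_sum_le u a T b
    rw [SimpleGraph.Walk.length_cons, Nat.cast_add, Nat.cast_one]
    linarith

end EulerianWalk

/-- Let `G` be a connected Eulerian digraph with `m` directed edges and let
`v, w` be vertices at distance `ℓ` in the underlying undirected graph. Then the commute time
of the simple random walk satisfies `C(v,w) = E_v[τ_{w}] + E_w[τ_{v}] ≤ m·ℓ` (each expected
hitting time `E_v[τ_A] = ∑_{t=0}^∞ ∑_{x∉A} Q^t(v,x)` being bounded through its partial sums). -/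
theorem eulerian_commute_time_le
    (V : Type) [Fintype V] [DecidableEq V] (E : V → V → Prop) [DecidableRel E]
    (hloop : ∀ x, ¬ E x x)
    (heul : ∀ x, dout E x = din E x)
    (hconn : (SimpleGraph.fromRel E).Connected)
    (v w : V) (ℓ : ℕ)
    (hdist : (SimpleGraph.fromRel E).dist v w = ℓ) :
    ∀ T : ℕ,
      hitTimePartial (srwP E) {w} v T + hitTimePartial (srwP E) {v} w T ≤
        (numEdges E : ℝ) * (ℓ : ℝ) := by
  intro T
  obtain ⟨p, hp⟩ := hconn.exists_walk_length_eq_dist v w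
  rw [← hdist, ← hp]
  exact commute_le_of_walk heul hconn p T
end

section
/- Let G be a connected Eulerian digraph on n vertices with m directed edges and minimal out-degree d_min = min_x d_out(x). Then for every starting vertex v, the simple random walk on G satisfies E_v[τ_cov] ≤ 16·m·n/d_min, where τ_cov = inf{t ≥ 0 : {X_0, X_1, …, X_t} = V} is the cover time of G. -/
open Finset

/-- `coverSurv P v t` is the probability, for the chain with transition matrix `P` started at
`v`, that not every vertex has been visited by time `t`, i.e. `P_v(τ_cov > t)`. -/
noncomputable def coverSurv {V : Type} [Fintype V] [DecidableEq V] (P : Matrix V V ℝ)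
    (v : V) (t : ℕ) : ℝ :=
  ∑ x : Fin (t + 1) → V,
    if x 0 = v ∧ Finset.univ.image x ≠ Finset.univ then pathWeight P x else 0

/-- The Laplacian of a weighted digraph with weights `w`. -/
noncomputable def weightedLap {V : Type*} [Fintype V] (w : V → V → ℝ) (f : V → ℝ) (x : V) : ℝ :=
  ∑ z, w x z * (f x - f z)

section WeightedLap

variable {V : Type*} [Fintype V] {w : V → V → ℝ}

lemma weightedLap_eq (w : V → V → ℝ) (f : V → ℝ) (x : V) :
    weightedLap w f x = (∑ z, w x z) * f x - ∑ z, w x z * f z := by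
  simp only [weightedLap, mul_sub, sum_sub_distrib, sum_mul]

lemma weightedLap_sub (w : V → V → ℝ) (f g : V → ℝ) (x : V) :
    weightedLap w (f - g) x = weightedLap w f x - weightedLap w g x := by
  simp only [weightedLap, ← sum_sub_distrib, Pi.sub_apply]
  exact sum_congr rfl fun z _ => by ring

lemma sum_weightedLap (bal : ∀ x, ∑ z, w x z = ∑ z, w z x) (f : V → ℝ) :
    ∑ x, weightedLap w f x = 0 := by
  simp only [weightedLap_eq, sum_sub_distrib]
  rw [sum_comm (f := fun x z => w x z * f z), sub_eq_zero]
  exact sum_congr rfl fun x _ => by rw [bal, sum_mul]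

/-- The Dirichlet energy of a balanced weighted digraph. -/
lemma sum_mul_weightedLap (bal : ∀ x, ∑ z, w x z = ∑ z, w z x) (f : V → ℝ) :
    ∑ x, f x * weightedLap w f x = 1 / 2 * ∑ x, ∑ z, w x z * (f x - f z) ^ 2 := by
  have h : ∑ x, ∑ z, w x z * f z ^ 2 = ∑ x, ∑ z, w x z * f x ^ 2 := by
    rw [sum_comm]
    exact sum_congr rfl fun x _ => by rw [← sum_mul, ← sum_mul, bal]
  have h₁ : ∑ x, f x * weightedLap w f x =
      ∑ x, ∑ z, w x z * f x ^ 2 - ∑ x, ∑ z, w x z * f x * f z := by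
    simp only [weightedLap, mul_sum, ← sum_sub_distrib]
    exact sum_congr rfl fun x _ => sum_congr rfl fun z _ => by ring
  have h₂ : ∑ x, ∑ z, w x z * (f x - f z) ^ 2 = ∑ x, ∑ z, w x z * f x ^ 2
      + ∑ x, ∑ z, w x z * f z ^ 2 - 2 * ∑ x, ∑ z, w x z * f x * f z := by
    simp only [mul_sum, ← sum_sub_distrib, ← sum_add_distrib]
    exact sum_congr rfl fun x _ => sum_congr rfl fun z _ => by ring
  rw [h₁, h₂, h]
  ring

lemma sum_mul_weightedLap_comm (symm : ∀ x z, w x z = w z x) (f g : V → ℝ) :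
    ∑ x, f x * weightedLap w g x = ∑ x, g x * weightedLap w f x := by
  have h : ∑ x, f x * ∑ z, w x z * g z = ∑ x, g x * ∑ z, w x z * f z := by
    simp only [mul_sum]
    rw [sum_comm]
    exact sum_congr rfl fun x _ => sum_congr rfl fun z _ => by rw [symm]; ring
  simp only [weightedLap_eq, mul_sub, sum_sub_distrib, h]
  congr 1
  exact sum_congr rfl fun x _ => by ring

/-- A weighted digraph with nonnegative weights is irreducible (as an undirected graph) if only
constant functions are constant along all edges. -/
def IsIrred (w : V → V → ℝ) : Prop :=
  ∀ f : V → ℝ, (∀ x z, w x z ≠ 0 → f x = f z) → ∀ x z, f x = f z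

lemma eq_of_weightedLap_eq_zero (nonneg : ∀ x z, 0 ≤ w x z)
    (bal : ∀ x, ∑ z, w x z = ∑ z, w z x) (irred : IsIrred w) {f : V → ℝ}
    (hf : ∀ x, weightedLap w f x = 0) (x z : V) : f x = f z := by
  refine irred f (fun x z hxz => ?_) x z
  have h := sum_mul_weightedLap bal f
  simp only [hf, mul_zero, sum_const_zero] at h
  have h0 : ∑ x, ∑ z, w x z * (f x - f z) ^ 2 = 0 := by linarith
  have hn : ∀ x z, 0 ≤ w x z * (f x - f z) ^ 2 := fun x z => mul_nonneg (nonneg x z) (sq_nonneg _)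
  rw [sum_eq_zero_iff_of_nonneg fun x _ => sum_nonneg fun z _ => hn x z] at h0
  have h1 := h0 x (mem_univ x)
  rw [sum_eq_zero_iff_of_nonneg fun z _ => hn x z] at h1
  have h2 := h1 z (mem_univ z)
  have h3 : f x - f z = 0 := by simpa [hxz] using h2
  linarith

variable [DecidableEq V]

/-- The Poisson equation is solvable on a balanced irreducible weighted digraph. -/
lemma exists_weightedLap_eq (nonneg : ∀ x z, 0 ≤ w x z)
    (bal : ∀ x, ∑ z, w x z = ∑ z, w z x) (irred : IsIrred w) (b : V → ℝ) (hb : ∑ x, b x = 0)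
    (y : V) : ∃ f : V → ℝ, f y = 0 ∧ ∀ x, weightedLap w f x = b x := by
  let A : (V → ℝ) →ₗ[ℝ] (V → ℝ) :=
    { toFun := fun f x => weightedLap w f x + if x = y then f y else 0
      map_add' := fun f g => by
        funext x
        simp only [weightedLap_eq, Pi.add_apply, mul_add, sum_add_distrib]
        split_ifs <;> ring
      map_smul' := fun c f => by
        funext x
        simp only [weightedLap_eq, Pi.smul_apply, smul_eq_mul, RingHom.id_apply, mul_left_comm _ c,
          ← mul_sum]
        split_ifs <;> ring }
  have key : ∀ f, ∑ x, A f x = 0 → f y = 0 := fun f hf => by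
    simpa [A, sum_add_distrib, sum_weightedLap bal] using hf
  have inj : Function.Injective A := by
    rw [← LinearMap.ker_eq_bot, LinearMap.ker_eq_bot']
    intro f hf
    have hy : f y = 0 := key f (by simp [hf])
    funext x
    rw [eq_of_weightedLap_eq_zero nonneg bal irred (f := f) (fun x => ?_) x y, hy, Pi.zero_apply]
    simpa [A, hy] using congrFun hf x
  obtain ⟨f, hf⟩ := LinearMap.injective_iff_surjective.1 inj b
  have hy : f y = 0 := key f (by rw [hf, hb])
  exact ⟨f, hy, fun x => by simpa [A, hy] using congrFun hf x⟩

/-- `H x y` is the expected time for the random walk with jump rates proportional to `w` to go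
from `x` to `y`; it is characterised by its Poisson equation. -/
structure IsHitting (w : V → V → ℝ) (H : V → V → ℝ) : Prop where
  diag : ∀ y, H y y = 0
  nonneg : ∀ x y, 0 ≤ H x y
  lap : ∀ x y, weightedLap w (fun u => H u y) x =
    (∑ z, w x z) - if x = y then ∑ u, ∑ z, w u z else 0

lemma exists_isHitting (nonneg : ∀ x z, 0 ≤ w x z)
    (bal : ∀ x, ∑ z, w x z = ∑ z, w z x) (irred : IsIrred w) (pos : ∀ x, 0 < ∑ z, w x z) :
    ∃ H, IsHitting w H := by
  have h : ∀ y, ∃ f : V → ℝ, f y = 0 ∧ ∀ x, weightedLap w f x =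
      (∑ z, w x z) - if x = y then ∑ u, ∑ z, w u z else 0 := fun y =>
    exists_weightedLap_eq nonneg bal irred _ (by simp [sum_sub_distrib]) y
  choose f hfy hf using h
  refine ⟨fun x y => f y x, hfy, fun x y => ?_, fun x y => hf y x⟩
  obtain ⟨x₀, -, hx₀⟩ := exists_min_image univ (f y) ⟨x, mem_univ x⟩
  have hle : weightedLap w (f y) x₀ ≤ 0 := sum_nonpos fun z _ =>
    mul_nonpos_of_nonneg_of_nonpos (nonneg x₀ z) (sub_nonpos.2 (hx₀ z (mem_univ z)))
  have : x₀ = y := by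
    by_contra hne
    rw [hf y x₀, if_neg hne, sub_zero] at hle
    exact absurd (pos x₀) hle.not_gt
  have := hx₀ x (mem_univ x)
  simp_all

/-- The commute time associated with hitting times `H`. -/
def commuteTime (H : V → V → ℝ) (x y : V) : ℝ := H x y + H y x

namespace IsHitting

variable {H : V → V → ℝ}

lemma commute_nonneg (hH : IsHitting w H) (x y : V) : 0 ≤ commuteTime H x y :=
  add_nonneg (hH.nonneg x y) (hH.nonneg y x)

/-- Foster's identity. -/
lemma foster (hH : IsHitting w H) :
    ∑ x, ∑ z, w x z * H z x = (Fintype.card V - 1) * ∑ x, ∑ z, w x z := by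
  have h : ∀ x, ∑ z, w x z * H z x = (∑ u, ∑ z, w u z) - ∑ z, w x z := fun x => by
    have := hH.lap x x
    rw [weightedLap_eq, hH.diag, if_pos rfl] at this
    linarith
  rw [sum_congr rfl fun x _ => h x, sum_sub_distrib, sum_const, card_univ, nsmul_eq_mul]
  ring

lemma lap_sub (hH : IsHitting w H) (x y u : V) :
    weightedLap w ((fun v => H v y) - fun v => H v x) u =
      (∑ u, ∑ z, w u z) * ((if u = x then 1 else 0) - if u = y then 1 else 0) := by
  rw [weightedLap_sub, hH.lap, hH.lap]
  split_ifs <;> ring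

lemma sum_mul_lap_sub (hH : IsHitting w H) (f : V → ℝ) (x y : V) :
    ∑ u, f u * weightedLap w ((fun v => H v y) - fun v => H v x) u =
      (∑ u, ∑ z, w u z) * (f x - f y) := by
  simp only [hH.lap_sub, mul_left_comm (f _)]
  simp [mul_sub, sum_sub_distrib]

lemma energy (hH : IsHitting w H) (x y : V) :
    ∑ u, ((fun v => H v y) - fun v => H v x) u *
      weightedLap w ((fun v => H v y) - fun v => H v x) u =
      (∑ u, ∑ z, w u z) * commuteTime H x y := by
  rw [hH.sum_mul_lap_sub]
  simp [commuteTime, hH.diag]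

lemma commute_le (hH : IsHitting w H) (nonneg : ∀ x z, 0 ≤ w x z)
    (bal : ∀ x, ∑ z, w x z = ∑ z, w z x) {x y : V} (hxy : w x y = 1) :
    commuteTime H x y ≤ 2 * ∑ u, ∑ z, w u z := by
  have h := hH.energy x y
  rw [sum_mul_weightedLap bal] at h
  set g : V → ℝ := (fun v => H v y) - fun v => H v x with hg
  have hn : ∀ u z, 0 ≤ w u z * (g u - g z) ^ 2 := fun u z => mul_nonneg (nonneg u z) (sq_nonneg _)
  have h1 : w x y * (g x - g y) ^ 2 ≤ ∑ u, ∑ z, w u z * (g u - g z) ^ 2 :=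
    (single_le_sum (f := fun z => w x z * (g x - g z) ^ 2) (fun z _ => hn x z) (mem_univ y)).trans
      (single_le_sum (f := fun u => ∑ z, w u z * (g u - g z) ^ 2)
        (fun u _ => sum_nonneg fun z _ => hn u z) (mem_univ x))
  have h2 : g x - g y = commuteTime H x y := by simp [hg, commuteTime, hH.diag]
  rw [hxy, h2, one_mul] at h1
  rcases (hH.commute_nonneg x y).eq_or_lt with h0 | h0
  · rw [← h0]
    have : 0 ≤ ∑ u, ∑ z, w u z := sum_nonneg fun u _ => sum_nonneg fun z _ => nonneg u z
    linarith
  · nlinarith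

/-- Commute times do not decrease under additive symmetrization of the weights. -/
lemma commute_le_symm (hH : IsHitting w H) {H' s : V → V → ℝ}
    (nonneg : ∀ x z, 0 ≤ w x z) (bal : ∀ x, ∑ z, w x z = ∑ z, w z x)
    (pos : 0 < ∑ u, ∑ z, w u z)
    (hs : ∀ x z, s x z = (w x z + w z x) / 2) (hH' : IsHitting s H') (x y : V) :
    commuteTime H x y ≤ commuteTime H' x y := by
  have ssymm : ∀ x z, s x z = s z x := fun x z => by rw [hs, hs, add_comm]
  have sbal : ∀ x, ∑ z, s x z = ∑ z, s z x := fun x => sum_congr rfl fun z _ => ssymm x z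
  have srow : ∀ x, ∑ z, s x z = ∑ z, w x z := fun x => by
    simp only [hs, ← sum_div, sum_add_distrib, ← bal x]
    ring
  have energy_eq : ∀ f : V → ℝ, ∑ u, f u * weightedLap s f u = ∑ u, f u * weightedLap w f u := by
    intro f
    rw [sum_mul_weightedLap bal, sum_mul_weightedLap sbal]
    have hc : ∑ x, ∑ z, w z x * (f x - f z) ^ 2 = ∑ x, ∑ z, w x z * (f x - f z) ^ 2 := by
      rw [sum_comm]
      exact sum_congr rfl fun x _ => sum_congr rfl fun z _ => by ring
    have : ∑ x, ∑ z, s x z * (f x - f z) ^ 2 = (∑ x, ∑ z, w x z * (f x - f z) ^ 2 +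
        ∑ x, ∑ z, w z x * (f x - f z) ^ 2) / 2 := by
      simp only [hs, ← sum_add_distrib, sum_div]
      exact sum_congr rfl fun x _ => sum_congr rfl fun z _ => by ring
    rw [this, hc]
    ring
  have e := hH.energy x y
  have e' := hH'.energy x y
  set g : V → ℝ := (fun v => H v y) - fun v => H v x with hg
  have m' := hH'.sum_mul_lap_sub g x y
  set g' : V → ℝ := (fun v => H' v y) - fun v => H' v x with hg'
  have hgg : g x - g y = commuteTime H x y := by simp [hg, commuteTime, hH.diag]
  simp only [srow] at e' m'
  have hpos : 0 ≤ ∑ u, (g - g') u * weightedLap s (g - g') u := by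
    rw [energy_eq, sum_mul_weightedLap bal]
    exact mul_nonneg (by norm_num) <| sum_nonneg fun u _ => sum_nonneg fun z _ =>
      mul_nonneg (nonneg u z) (sq_nonneg _)
  have hexp : ∑ u, (g - g') u * weightedLap s (g - g') u =
      ∑ u, g u * weightedLap s g u - ∑ u, g u * weightedLap s g' u
        - ∑ u, g' u * weightedLap s g u + ∑ u, g' u * weightedLap s g' u := by
    simp only [weightedLap_sub, ← sum_sub_distrib, ← sum_add_distrib, Pi.sub_apply]
    exact sum_congr rfl fun u _ => by ring
  rw [hexp, sum_mul_weightedLap_comm ssymm g' g, energy_eq g, e, e', m', hgg] at hpos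
  exact le_of_mul_le_mul_left (by linarith) pos

/-- The total commute time over all edges. -/
lemma sum_commute_le (hH : IsHitting w H) (nonneg : ∀ x z, 0 ≤ w x z)
    (bal : ∀ x, ∑ z, w x z = ∑ z, w z x) (irred : IsIrred w) (pos : ∀ x, 0 < ∑ z, w x z) :
    ∑ x, ∑ z, w x z * commuteTime H x z ≤ 2 * ((∑ x, ∑ z, w x z) * Fintype.card V) := by
  rcases isEmpty_or_nonempty V with _ | _
  · simp
  have mpos : 0 < ∑ u, ∑ z, w u z := sum_pos (fun u _ => pos u) univ_nonempty
  obtain ⟨s, hs⟩ : ∃ s : V → V → ℝ, ∀ x z, s x z = (w x z + w z x) / 2 := ⟨_, fun _ _ => rfl⟩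
  have ssymm : ∀ x z, s x z = s z x := fun x z => by rw [hs, hs, add_comm]
  have srow : ∀ x, ∑ z, s x z = ∑ z, w x z := fun x => by
    simp only [hs, ← sum_div, sum_add_distrib, ← bal x]
    ring
  obtain ⟨H', hH'⟩ : ∃ H', IsHitting s H' := by
    refine exists_isHitting (fun x z => ?_) (fun x => sum_congr rfl fun z _ => ssymm x z)
      (fun f hf => irred f fun x z hxz => hf x z ?_) fun x => by rw [srow]; exact pos x
    · have := nonneg x z
      have := nonneg z x
      rw [hs]
      positivity
    · have h₁ := (nonneg x z).lt_of_ne' hxz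
      have h₂ := nonneg z x
      rw [hs]
      positivity
  have hF := hH'.foster
  simp only [srow] at hF
  have hF' : ∑ x, ∑ z, s x z * H' x z = ∑ x, ∑ z, s x z * H' z x := by
    rw [sum_comm]
    exact sum_congr rfl fun x _ => sum_congr rfl fun z _ => by rw [ssymm]
  have hle : ∑ x, ∑ z, w x z * commuteTime H x z ≤ ∑ x, ∑ z, w x z * commuteTime H' x z :=
    sum_le_sum fun x _ => sum_le_sum fun z _ => mul_le_mul_of_nonneg_left
      (hH.commute_le_symm nonneg bal mpos hs hH' x z) (nonneg x z)
  have hc : ∑ x, ∑ z, w z x * commuteTime H' x z = ∑ x, ∑ z, w x z * commuteTime H' x z := by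
    rw [sum_comm]
    exact sum_congr rfl fun x _ => sum_congr rfl fun z _ => by rw [commuteTime, commuteTime, add_comm]
  have heq : ∑ x, ∑ z, w x z * commuteTime H' x z =
      ∑ x, ∑ z, s x z * H' x z + ∑ x, ∑ z, s x z * H' z x := by
    have h2 : 2 * (∑ x, ∑ z, s x z * H' x z + ∑ x, ∑ z, s x z * H' z x) =
        ∑ x, ∑ z, w x z * commuteTime H' x z + ∑ x, ∑ z, w z x * commuteTime H' x z := by
      simp only [hs, commuteTime, mul_sum, ← sum_add_distrib]
      exact sum_congr rfl fun x _ => sum_congr rfl fun z _ => by ring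
    linarith
  rw [heq, hF', hF] at hle
  linarith

end IsHitting

end WeightedLap

section Survival

variable {V : Type} [Fintype V] [DecidableEq V]

/-- The probability that the chain started at `v` has not visited all vertices outside `W` by
time `t`. -/
noncomputable def coverSurvFrom (P : Matrix V V ℝ) (W : Finset V) (v : V) (t : ℕ) : ℝ :=
  ∑ x : Fin (t + 1) → V, if x 0 = v ∧ W ∪ univ.image x ≠ univ then pathWeight P x else 0

lemma coverSurvFrom_empty (P : Matrix V V ℝ) (v : V) (t : ℕ) :
    coverSurvFrom P ∅ v t = coverSurv P v t := by
  simp [coverSurvFrom, coverSurv]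

lemma coverSurvFrom_zero (P : Matrix V V ℝ) (W : Finset V) (v : V) :
    coverSurvFrom P W v 0 = if insert v W ≠ univ then 1 else 0 := by
  have h : ∀ x : Fin 1 → V, (if x 0 = v ∧ W ∪ univ.image x ≠ univ then pathWeight P x else 0) =
      if x = fun _ => v then (if insert v W ≠ univ then 1 else 0) else 0 := by
    intro x
    have hx : x = (fun _ => v) ↔ x 0 = v := by
      refine ⟨fun h => by rw [h], fun h => funext fun i => by rw [Subsingleton.elim i 0, h]⟩
    by_cases hv : x 0 = v
    · simp [hx, hv, pathWeight, union_comm W]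
    · simp [hx, hv]
  rw [coverSurvFrom, sum_congr rfl fun x _ => h x]
  simp

lemma coverSurvFrom_succ (P : Matrix V V ℝ) (W : Finset V) (v : V) (t : ℕ) :
    coverSurvFrom P W v (t + 1) = ∑ z, P v z * coverSurvFrom P (insert v W) z t := by
  have himg : ∀ (a : V) (x : Fin (t + 1) → V),
      W ∪ univ.image (Fin.cons a x : Fin (t + 2) → V) = insert a W ∪ univ.image x := by
    intro a x
    ext y
    simp [Fin.exists_fin_succ, eq_comm, or_left_comm]
  have hw : ∀ (a : V) (x : Fin (t + 1) → V),
      pathWeight P (Fin.cons a x : Fin (t + 2) → V) = P a (x 0) * pathWeight P x := by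
    intro a x
    simp [pathWeight, Fin.prod_univ_succ]
  have hsum : ∀ F : (Fin (t + 2) → V) → ℝ, ∑ x, F x = ∑ a, ∑ x, F (Fin.cons a x) := by
    intro F
    rw [← (Fin.consEquiv fun _ : Fin (t + 2) => V).sum_comp, Fintype.sum_prod_type]
    rfl
  rw [coverSurvFrom, hsum]
  simp only [Fin.cons_zero, himg, hw]
  rw [sum_eq_single v (fun a _ ha => by simp [ha]) (by simp)]
  simp only [coverSurvFrom, mul_sum]
  rw [sum_comm]
  refine sum_congr rfl fun x _ => ?_
  rw [sum_eq_single (x 0) (fun z _ hz => by simp [Ne.symm hz]) (by simp)]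
  simp

lemma sum_coverSurvFrom_succ (P : Matrix V V ℝ) (W : Finset V) (v : V) (T : ℕ) :
    ∑ t ∈ range (T + 1), coverSurvFrom P W v t = (if insert v W ≠ univ then 1 else 0) +
      ∑ z, P v z * ∑ t ∈ range T, coverSurvFrom P (insert v W) z t := by
  rw [sum_range_succ', coverSurvFrom_zero, add_comm]
  simp only [coverSurvFrom_succ, mul_sum]
  rw [sum_comm]

lemma coverSurvFrom_univ (P : Matrix V V ℝ) (v : V) (t : ℕ) :
    coverSurvFrom P univ v t = 0 := by
  simp [coverSurvFrom]

end Survival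

section Route

variable {V : Type*} [DecidableEq V] {H : V → V → ℝ}

/-- `Route H u v S c`: some finite sequence of vertices from `u` to `v` has set of vertices `S`
and total cost `c`, a step from `x` to `y` costing `H x y`. -/
inductive Route (H : V → V → ℝ) : V → V → Finset V → ℝ → Prop
  | nil (u : V) : Route H u u {u} 0
  | cons (u : V) {y v : V} {S : Finset V} {c : ℝ} (h : Route H y v S c) :
      Route H u v (insert u S) (H u y + c)

namespace Route

lemma nonneg (hH : ∀ x y, 0 ≤ H x y) {u v : V} {S : Finset V} {c : ℝ} (h : Route H u v S c) :
    0 ≤ c := by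
  induction h with
  | nil => exact le_rfl
  | cons u h ih => exact add_nonneg (hH _ _) ih

lemma start_mem {u v : V} {S : Finset V} {c : ℝ} (h : Route H u v S c) : u ∈ S := by
  cases h <;> simp

lemma trans {u v x : V} {S S' : Finset V} {c c' : ℝ} (h : Route H u v S c)
    (h' : Route H v x S' c') : Route H u x (S ∪ S') (c + c') := by
  induction h with
  | nil u => simpa [insert_eq_self.2 h'.start_mem] using h'
  | cons u h ih =>
    rw [insert_union, add_assoc]
    exact (ih h').cons u

lemma step (x y : V) : Route H x y {x, y} (H x y) := by
  simpa using (Route.nil (H := H) y).cons x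

lemma split {u v x : V} {S : Finset V} {c : ℝ} (h : Route H u v S c) (hx : x ∈ S) :
    ∃ S₁ S₂ c₁ c₂, Route H u x S₁ c₁ ∧ Route H x v S₂ c₂ ∧ S₁ ∪ S₂ = S ∧ c₁ + c₂ = c := by
  induction h with
  | nil u =>
    obtain rfl := mem_singleton.1 hx
    exact ⟨_, _, _, _, .nil x, .nil x, union_self _, zero_add _⟩
  | @cons u y v S c h ih =>
    by_cases hxu : x = u
    · subst hxu
      refine ⟨_, _, _, _, .nil x, h.cons x, ?_, zero_add _⟩
      simp
    · obtain ⟨S₁, S₂, c₁, c₂, h₁, h₂, rfl, rfl⟩ := ih (mem_of_mem_insert_of_ne hx hxu)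
      exact ⟨_, _, _, _, h₁.cons u, h₂, insert_union .., add_assoc ..⟩

lemma rotate {v x : V} {S : Finset V} {c : ℝ} (h : Route H v v S c) (hx : x ∈ S) :
    Route H x x S c := by
  obtain ⟨S₁, S₂, c₁, c₂, h₁, h₂, rfl, rfl⟩ := h.split hx
  rw [union_comm, add_comm]
  exact h₂.trans h₁

end Route

/-- `S` is contained in a closed route of cost at most `c`. -/
def Tour (H : V → V → ℝ) (S : Finset V) (c : ℝ) : Prop :=
  ∃ v S' c', Route H v v S' c' ∧ S ⊆ S' ∧ c' ≤ c

namespace Tour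

lemma mono {S S' : Finset V} {c c' : ℝ} (h : Tour H S c) (hS : S' ⊆ S) (hc : c ≤ c') :
    Tour H S' c' := by
  obtain ⟨v, S₁, c₁, h, hS₁, hc₁⟩ := h
  exact ⟨v, S₁, c₁, h, hS.trans hS₁, hc₁.trans hc⟩

lemma singleton (x : V) : Tour H {x} 0 := ⟨x, _, _, .nil x, subset_rfl, le_rfl⟩

lemma join {S T : Finset V} {c c' : ℝ} (hS : Tour H S c) (hT : Tour H T c') {x y : V}
    (hx : x ∈ S) (hy : y ∈ T) : Tour H (S ∪ T) (c + c' + commuteTime H x y) := by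
  obtain ⟨v, S₁, c₁, h₁, hS₁, hc₁⟩ := hS
  obtain ⟨v', T₁, c₂, h₂, hT₁, hc₂⟩ := hT
  refine ⟨x, _, _, (h₁.rotate (hS₁ hx)).trans ((Route.step x y).trans
    ((h₂.rotate (hT₁ hy)).trans (Route.step y x))), fun z hz => ?_, ?_⟩
  · rcases mem_union.1 hz with hz | hz
    · exact mem_union_left _ (hS₁ hz)
    · exact mem_union_right _ (mem_union_right _ (mem_union_left _ (hT₁ hz)))
  · rw [commuteTime]
    linarith

end Tour

end Route

/-- A route through all unvisited vertices bounds the expected remaining cover time. -/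
lemma Route.sum_coverSurvFrom_le {V : Type} [Fintype V] [DecidableEq V] {P : Matrix V V ℝ}
    {H : V → V → ℝ} (Pnonneg : ∀ x z, 0 ≤ P x z) (Psum : ∀ x, ∑ z, P x z = 1)
    (Hdiag : ∀ x, H x x = 0) (Hnonneg : ∀ x y, 0 ≤ H x y)
    (Hstep : ∀ x y, x ≠ y → H x y = 1 + ∑ z, P x z * H z y) (T : ℕ) :
    ∀ {u v : V} {S W : Finset V} {c : ℝ}, Route H u v S c → W ∪ S = univ →
      ∑ t ∈ range T, coverSurvFrom P W u t ≤ c := by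
  induction T with
  | zero =>
    intro u v S W c h _
    simpa using h.nonneg Hnonneg
  | succ T ihT =>
    intro u v S W c h
    induction h with
    | nil u =>
      intro hW
      have hW' : insert u W = univ := by rw [← hW, union_comm]; rfl
      simp [sum_coverSurvFrom_succ, hW', coverSurvFrom_univ]
    | @cons u y v S c h ih =>
      intro hW
      by_cases huy : u = y
      · subst huy
        rw [Hdiag, zero_add]
        exact ih (by rwa [insert_eq_self.2 h.start_mem] at hW)
      · have hW' : ∀ z, insert u W ∪ insert z S = univ := fun z => by
          rw [union_insert, insert_union, ← union_insert, hW, insert_eq_self.2 (mem_univ z)]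
        calc _ ≤ 1 + ∑ z, P u z * (H z y + c) := by
              rw [sum_coverSurvFrom_succ]
              refine add_le_add (by split_ifs <;> norm_num) (sum_le_sum fun z _ => ?_)
              exact mul_le_mul_of_nonneg_left (ihT (h.cons z) (hW' z)) (Pnonneg u z)
          _ = H u y + c := by
              simp only [mul_add, sum_add_distrib, ← sum_mul, Psum, Hstep u y huy]
              ring

/-- Greedy packing: among sets `B x` with radii `ρ x`, a disjoint subfamily such that each `B x`
meets a member of the subfamily of no larger radius. -/
lemma exists_disjoint_packing {V : Type*} [DecidableEq V] (ρ : V → ℝ) (B : V → Finset V)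
    (hB : ∀ x, x ∈ B x) (U : Finset V) :
    ∃ A ⊆ U, (A : Set V).PairwiseDisjoint B ∧
      ∀ x ∈ U, ∃ a ∈ A, ρ a ≤ ρ x ∧ ¬ Disjoint (B x) (B a) := by
  induction U using Finset.induction_on_max_value ρ with
  | empty => exact ⟨∅, by simp⟩
  | insert x U hx hmax ih =>
    obtain ⟨A, hAU, hA, hcov⟩ := ih
    by_cases h : ∃ a ∈ A, ¬ Disjoint (B x) (B a)
    · obtain ⟨a, ha, hd⟩ := h
      refine ⟨A, hAU.trans (subset_insert _ _), hA, fun y hy => ?_⟩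
      rcases mem_insert.1 hy with rfl | hy
      · exact ⟨a, ha, hmax a (hAU ha), hd⟩
      · exact hcov y hy
    · push Not at h
      refine ⟨insert x A, insert_subset_insert _ hAU, ?_, fun y hy => ?_⟩
      · rw [coe_insert]
        exact hA.insert fun a ha _ => h a ha
      · rcases mem_insert.1 hy with rfl | hy
        · refine ⟨y, mem_insert_self _ _, le_rfl, ?_⟩
          rw [disjoint_self_iff_empty]
          exact ne_empty_of_mem (hB y)
        · obtain ⟨a, ha, h⟩ := hcov y hy
          exact ⟨a, mem_insert_of_mem ha, h⟩

lemma commuteTime_comm {V : Type*} (H : V → V → ℝ) (x y : V) : commuteTime H x y = commuteTime H y x :=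
  add_comm _ _

section Cover

variable {V : Type*} [Fintype V] [DecidableEq V] {H : V → V → ℝ}

/-- A cluster of vertices whose balls meet the ball of a center `a` of smaller radius. -/
lemma tour_cluster {ρ : V → ℝ} {B : V → Finset V}
    (hBρ : ∀ x, ∀ y ∈ B x, commuteTime H x y ≤ ρ x) (a : V) (F : Finset V)
    (hF : ∀ x ∈ F, ρ a ≤ ρ x ∧ ¬ Disjoint (B x) (B a)) :
    Tour H (insert a F) (∑ x ∈ F, 2 * ρ x) := by
  induction F using Finset.induction_on with
  | empty => simpa using Tour.singleton a
  | insert x F hx ih =>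
    have ih := ih fun z hz => hF z (mem_insert_of_mem hz)
    obtain ⟨hρ, hd⟩ := hF x (mem_insert_self _ _)
    obtain ⟨y, hyx, hya⟩ := not_disjoint_iff.1 hd
    have hxy := (Tour.singleton (H := H) x).join (Tour.singleton y) (mem_singleton_self x)
      (mem_singleton_self y)
    refine (ih.join hxy (mem_insert_self a F) (y := y) (by simp)).mono ?_ ?_
    · intro z
      simp
      tauto
    · rw [sum_insert hx]
      have := hBρ x y hyx
      have := hBρ a y hya
      linarith

/-- Clusters partitioning the vertices are merged one at a time along edges of bounded commute
time. -/
lemma tour_clusters {M : ℝ} {ρ : V → ℝ} {A : Finset V} {f : V → V}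
    (hfA : ∀ x, f x ∈ A) (hfa : ∀ a ∈ A, f a = a)
    (hcl : ∀ a ∈ A, Tour H (univ.filter fun x => f x = a) (∑ x with f x = a, 2 * ρ x))
    (hcross : ∀ U : Finset V, U.Nonempty → U ≠ univ →
      ∃ x ∈ U, ∃ y ∉ U, commuteTime H x y ≤ M) (j : ℕ) (hj : j < A.card) :
    ∃ A' ⊆ A, A'.card = j + 1 ∧
      Tour H (univ.filter fun x => f x ∈ A') (∑ x with f x ∈ A', 2 * ρ x + M * j) := by
  induction j with
  | zero =>
    obtain ⟨a, ha⟩ := card_pos.1 hj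
    exact ⟨{a}, by simpa using ha, by simp, by simpa using hcl a ha⟩
  | succ j ih =>
    obtain ⟨A', hA', hcard, htour⟩ := ih (by omega)
    obtain ⟨b, hb, hbA'⟩ := exists_of_ssubset
      (hA'.ssubset_of_ne fun h => by rw [h] at hcard; omega)
    obtain ⟨a, ha⟩ : A'.Nonempty := card_pos.1 (by omega)
    obtain ⟨x, hx, y, hy, hxy⟩ := hcross (univ.filter fun x => f x ∈ A')
      ⟨a, by simpa [hfa a (hA' ha)] using ha⟩ fun h => by
        have : b ∈ univ.filter fun x => f x ∈ A' := by rw [h]; exact mem_univ b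
        simp [hfa b hb, hbA'] at this
    have hy' : f y ∉ A' := by simpa using hy
    have hunion : (univ.filter fun x => f x ∈ insert (f y) A') =
        (univ.filter fun x => f x ∈ A') ∪ univ.filter fun x => f x = f y := by
      ext z
      simp [or_comm]
    refine ⟨insert (f y) A', insert_subset (hfA y) hA', by rw [card_insert_of_notMem hy', hcard],
      (htour.join (hcl _ (hfA y)) hx (y := y) (by simp)).mono hunion.le ?_⟩
    rw [hunion, sum_union]
    · push_cast
      linarith
    · refine disjoint_filter.2 fun z _ hz hzy => hy' (hzy ▸ hz)

/-- A tour through all vertices assembled from a disjoint packing of commute-time balls. -/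
lemma exists_tour_s13 [Nonempty V] {M K : ℝ} (hM : 0 ≤ M) {ρ : V → ℝ} {B : V → Finset V}
    (hB : ∀ x, x ∈ B x) (hBρ : ∀ x, ∀ y ∈ B x, commuteTime H x y ≤ ρ x)
    (hK : 0 < K) (hcard : ∀ x, K ≤ (B x).card)
    (hcross : ∀ U : Finset V, U.Nonempty → U ≠ univ →
      ∃ x ∈ U, ∃ y ∉ U, commuteTime H x y ≤ M) :
    Tour H univ (2 * ∑ x, ρ x + M * (Fintype.card V / K)) := by
  obtain ⟨A, -, hA, hcov⟩ := exists_disjoint_packing ρ B hB univ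
  choose f hfA hfρ hfd using fun x => hcov x (mem_univ x)
  have hfa : ∀ a ∈ A, f a = a := fun a ha => by
    by_contra hne
    exact hfd a (hA ha (hfA a) (Ne.symm hne))
  have hcl : ∀ a ∈ A, Tour H (univ.filter fun x => f x = a) (∑ x with f x = a, 2 * ρ x) := by
    intro a _
    refine (tour_cluster hBρ a _ fun x hx => ?_).mono (subset_insert _ _) le_rfl
    obtain rfl : f x = a := by simpa using hx
    exact ⟨hfρ x, hfd x⟩
  have hpos : 0 < A.card := card_pos.2 ⟨_, hfA (Classical.arbitrary V)⟩
  obtain ⟨A', hA', hc, htour⟩ := tour_clusters hfA hfa hcl hcross (A.card - 1) (by omega)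
  obtain rfl : A' = A := eq_of_subset_of_card_le hA' (by omega)
  have hAK : (A'.card : ℝ) ≤ Fintype.card V / K := by
    rw [le_div_iff₀ hK, ← nsmul_eq_mul]
    calc A'.card • K ≤ ∑ a ∈ A', ((B a).card : ℝ) := card_nsmul_le_sum _ _ _ fun a _ => hcard a
      _ = ((A'.biUnion B).card : ℝ) := by rw [card_biUnion hA]; push_cast; rfl
      _ ≤ Fintype.card V := by exact_mod_cast card_le_univ _
  refine htour.mono (fun x _ => by simpa using hfA x) ?_
  have h1 : ((A'.card - 1 : ℕ) : ℝ) ≤ Fintype.card V / K :=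
    le_trans (by exact_mod_cast Nat.sub_le _ _) hAK
  have h2 := mul_le_mul_of_nonneg_left h1 hM
  have h3 : ∑ x with f x ∈ A', 2 * ρ x = 2 * ∑ x, ρ x := by
    rw [filter_true_of_mem fun x _ => hfA x, mul_sum]
  linarith

end Cover

/-- At least half of the members of a finite family are at most twice the average. -/
lemma card_le_two_mul_card_filter_le {ι : Type*} (s : Finset ι) (g : ι → ℝ)
    (hg : ∀ i ∈ s, 0 ≤ g i) :
    s.card ≤ 2 * (s.filter fun i => g i ≤ 2 * (∑ j ∈ s, g j) / s.card).card := by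
  set r := 2 * (∑ j ∈ s, g j) / s.card with hr
  have hsplit := card_filter_add_card_filter_not (s := s) fun i => g i ≤ r
  by_contra! hlt
  set L := s.filter fun i => ¬ g i ≤ r with hL
  have hlt' : s.card < 2 * L.card := by omega
  have hLpos : L.Nonempty := card_pos.1 (by omega)
  have hspos : (0 : ℝ) < s.card := by
    exact_mod_cast (card_pos.2 (hLpos.mono (filter_subset _ _)))
  have hr0 : 0 ≤ r := div_nonneg (mul_nonneg zero_le_two (sum_nonneg hg)) hspos.le
  have h1 : L.card * r < ∑ j ∈ s, g j := by
    rw [← nsmul_eq_mul, ← sum_const]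
    calc ∑ _i ∈ L, r < ∑ i ∈ L, g i :=
          sum_lt_sum_of_nonempty hLpos fun i hi => not_le.1 (mem_filter.1 hi).2
      _ ≤ ∑ i ∈ s, g i := sum_le_sum_of_subset_of_nonneg (filter_subset _ _) fun i hi _ => hg i hi
  have h2 : s.card * r = 2 * ∑ j ∈ s, g j := by
    rw [hr]
    field_simp
  have h3 : (s.card : ℝ) ≤ 2 * L.card := by exact_mod_cast hlt'.le
  nlinarith

section Eulerian

variable {V : Type} (E : V → V → Prop) [DecidableRel E]

/-- The adjacency weights of a digraph. -/
def edgeWeight (x y : V) : ℝ := if E x y then 1 else 0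

lemma edgeWeight_nonneg (x y : V) : 0 ≤ edgeWeight E x y := by
  unfold edgeWeight
  split_ifs <;> norm_num

variable {E} in
lemma isIrred_edgeWeight (hconn : (SimpleGraph.fromRel E).Connected) :
    IsIrred (edgeWeight E) := by
  intro f hf x z
  have h : ∀ x z, E x z → f x = f z := fun x z hxz => hf x z (by simp [edgeWeight, hxz])
  obtain ⟨p⟩ := hconn.preconnected x z
  induction p with
  | nil => rfl
  | cons hadj p ih =>
    rw [← ih]
    rcases ((SimpleGraph.fromRel_adj _ _ _).1 hadj).2 with h' | h'
    · exact h _ _ h'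
    · exact (h _ _ h').symm

variable [Fintype V]

lemma sum_edgeWeight (x : V) : ∑ z, edgeWeight E x z = dout E x := by
  simp [edgeWeight, dout]

lemma sum_edgeWeight_in (x : V) : ∑ z, edgeWeight E z x = din E x := by
  simp [edgeWeight, din]

lemma sum_sum_edgeWeight : ∑ x, ∑ z, edgeWeight E x z = numEdges E := by
  simp [sum_edgeWeight, numEdges]

variable {E}

lemma dout_pos [Nontrivial V] (heul : ∀ x, dout E x = din E x)
    (hconn : (SimpleGraph.fromRel E).Connected) (x : V) : 0 < dout E x := by
  obtain ⟨y, hy⟩ := hconn.preconnected.exists_adj_of_nontrivial x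
  rcases ((SimpleGraph.fromRel_adj _ _ _).1 hy).2 with h | h
  · exact card_pos.2 ⟨y, by simpa using h⟩
  · rw [heul]
    exact card_pos.2 ⟨y, by simpa using h⟩

variable [DecidableEq V]

lemma srwP_eq_s13 (x z : V) : srwP E x z = edgeWeight E x z / dout E x := by
  unfold srwP edgeWeight
  split_ifs <;> simp

lemma IsHitting.eq_one_add_sum_srwP {H : V → V → ℝ} (hH : IsHitting (edgeWeight E) H) {x y : V}
    (hpos : 0 < dout E x) (hxy : x ≠ y) : H x y = 1 + ∑ z, srwP E x z * H z y := by
  have h := hH.lap x y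
  rw [weightedLap_eq, if_neg hxy, sum_edgeWeight, sub_zero] at h
  have hd : (dout E x : ℝ) ≠ 0 := by positivity
  simp only [srwP_eq_s13, div_mul_eq_mul_div, ← sum_div]
  field_simp
  linarith

lemma exists_tour_eulerian [Nontrivial V] (heul : ∀ x, dout E x = din E x)
    (hconn : (SimpleGraph.fromRel E).Connected) {d : ℝ} (hd : 0 < d)
    (hdle : ∀ x, d ≤ dout E x) {H : V → V → ℝ} (hH : IsHitting (edgeWeight E) H) :
    Tour H univ (12 * numEdges E * Fintype.card V / d) := by
  have hnn := edgeWeight_nonneg E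
  have hbal : ∀ x, ∑ z, edgeWeight E x z = ∑ z, edgeWeight E z x := fun x => by
    rw [sum_edgeWeight, sum_edgeWeight_in, heul]
  have hirr := isIrred_edgeWeight hconn
  have hdpos := dout_pos heul hconn
  have hedge : ∀ x y, E x y → commuteTime H x y ≤ 2 * numEdges E := fun x y hxy => by
    rw [← sum_sum_edgeWeight]
    exact hH.commute_le hnn hbal (by simp [edgeWeight, hxy])
  have htotal := hH.sum_commute_le hnn hbal hirr fun x => by
    rw [sum_edgeWeight]
    exact_mod_cast hdpos x
  rw [sum_sum_edgeWeight] at htotal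
  set N : V → Finset V := fun x => univ.filter fun y => E x y with hN
  have hNcard : ∀ x, (N x).card = dout E x := fun x => rfl
  set ρ : V → ℝ := fun x => 2 * (∑ y ∈ N x, commuteTime H x y) / (N x).card with hρ
  have hρ0 : ∀ x, 0 ≤ ρ x := fun x =>
    div_nonneg (mul_nonneg zero_le_two (sum_nonneg fun y _ => hH.commute_nonneg x y))
      (Nat.cast_nonneg _)
  have hρsum : ∑ x, ρ x ≤ 4 * numEdges E * Fintype.card V / d := by
    have h1 : ∀ x, ρ x ≤ 2 / d * ∑ z, edgeWeight E x z * commuteTime H x z := fun x => by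
      have hs : ∑ z, edgeWeight E x z * commuteTime H x z = ∑ y ∈ N x, commuteTime H x y := by
        simp [edgeWeight, hN, sum_filter]
      have h0 : 0 ≤ 2 * ∑ y ∈ N x, commuteTime H x y :=
        mul_nonneg zero_le_two (sum_nonneg fun y _ => hH.commute_nonneg x y)
      rw [hs, div_mul_eq_mul_div]
      exact div_le_div_of_nonneg_left h0 hd (hdle x)
    calc ∑ x, ρ x ≤ 2 / d * ∑ x, ∑ z, edgeWeight E x z * commuteTime H x z := by
          rw [mul_sum]
          exact sum_le_sum fun x _ => h1 x
      _ ≤ 2 / d * (2 * (numEdges E * Fintype.card V)) := by gcongr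
      _ = _ := by ring
  have hBcard : ∀ x, d / 2 ≤
      (insert x ((N x).filter fun y => commuteTime H x y ≤ ρ x)).card := fun x => by
    have h := card_le_two_mul_card_filter_le (N x) (commuteTime H x) fun y _ =>
      hH.commute_nonneg x y
    have h' := card_le_card (subset_insert x ((N x).filter fun y => commuteTime H x y ≤ ρ x))
    have h1 : ((dout E x : ℕ) : ℝ) ≤
        2 * (insert x ((N x).filter fun y => commuteTime H x y ≤ ρ x)).card := by
      rw [← hNcard]
      exact_mod_cast h.trans (Nat.mul_le_mul_left 2 h')
    linarith [hdle x]
  have hcross : ∀ U : Finset V, U.Nonempty → U ≠ univ →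
      ∃ x ∈ U, ∃ y ∉ U, commuteTime H x y ≤ 2 * numEdges E := by
    rintro U ⟨a, ha⟩ hU
    obtain ⟨b, hb⟩ : ∃ b, b ∉ U := by
      by_contra! h
      exact hU (eq_univ_of_forall h)
    by_contra! hno
    have := hirr (fun x => if x ∈ U then 1 else 0) (fun x z hxz => ?_) a b
    · simp [ha, hb] at this
    · have hE : E x z := by
        by_contra h
        exact hxz (by simp [edgeWeight, h])
      by_cases hx : x ∈ U <;> by_cases hz : z ∈ U
      · simp [hx, hz]
      · exact absurd (hedge x z hE) (hno x hx z hz).not_ge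
      · have := hno z hz x hx
        rw [commuteTime_comm] at this
        exact absurd (hedge x z hE) this.not_ge
      · simp [hx, hz]
  refine (exists_tour_s13 (ρ := ρ) (by positivity)
    (B := fun x => insert x ((N x).filter fun y => commuteTime H x y ≤ ρ x))
    (fun x => mem_insert_self _ _) (fun x y hy => ?_) (half_pos hd) hBcard hcross).mono
      subset_rfl ?_
  · rcases mem_insert.1 hy with rfl | hy
    · simpa [commuteTime, hH.diag] using hρ0 y
    · exact (mem_filter.1 hy).2
  · calc _ ≤ 2 * (4 * numEdges E * Fintype.card V / d) +
          2 * numEdges E * (Fintype.card V / (d / 2)) := by gcongr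
      _ = _ := by
        field_simp
        ring

end Eulerian

/-- Let `G` be a connected Eulerian digraph on `n` vertices with `m` directed
edges and minimal out-degree `d_min`. For every starting vertex `v`, the simple random walk
satisfies `E_v[τ_cov] ≤ 16·m·n/d_min` (expressed via `E_v[τ_cov] = ∑_{t≥0} P_v(τ_cov > t)`,
bounded through all its partial sums). -/
theorem eulerian_cover_time
    (V : Type) [Fintype V] [DecidableEq V] (E : V → V → Prop) [DecidableRel E]
    (hloop : ∀ x, ¬ E x x)
    (heul : ∀ x, dout E x = din E x)
    (hconn : (SimpleGraph.fromRel E).Connected)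
    (v : V) :
    ∀ T : ℕ,
      ∑ t ∈ Finset.range T, coverSurv (srwP E) v t ≤
        16 * (numEdges E : ℝ) * (Fintype.card V : ℝ) /
          ((sInf (Set.range fun x => dout E x) : ℕ) : ℝ) := by
  intro T
  rcases subsingleton_or_nontrivial V with _ | _
  · have h : ∀ t, coverSurv (srwP E) v t = 0 := fun t => sum_eq_zero fun x _ => by
      rw [if_neg]
      rintro ⟨-, h⟩
      exact h (eq_univ_of_forall fun y => mem_image.2 ⟨0, mem_univ _, Subsingleton.elim _ _⟩)
    simp only [h, sum_const_zero]
    positivity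
  have hdpos := dout_pos heul hconn
  obtain ⟨x₀, hx₀⟩ := Nat.sInf_mem (Set.range_nonempty fun x => dout E x)
  have hd : (0 : ℝ) < (sInf (Set.range fun x => dout E x) : ℕ) := by
    rw [← hx₀]
    exact_mod_cast hdpos x₀
  have hdle : ∀ x, ((sInf (Set.range fun x => dout E x) : ℕ) : ℝ) ≤ dout E x := fun x => by
    exact_mod_cast Nat.sInf_le (Set.mem_range_self x)
  obtain ⟨H, hH⟩ := exists_isHitting (edgeWeight_nonneg E)
    (fun x => by rw [sum_edgeWeight, sum_edgeWeight_in, heul]) (isIrred_edgeWeight hconn)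
    (fun x => by rw [sum_edgeWeight]; exact_mod_cast hdpos x)
  obtain ⟨u, S, c, hr, hS, hc⟩ := exists_tour_eulerian heul hconn hd hdle hH
  have hroute := hr.rotate (hS (mem_univ v))
  have hcov := Route.sum_coverSurvFrom_le (P := srwP E)
    (fun x z => by
      rw [srwP_eq_s13]
      exact div_nonneg (edgeWeight_nonneg E x z) (Nat.cast_nonneg _))
    (fun x => by
      have : (dout E x : ℝ) ≠ 0 := by exact_mod_cast (hdpos x).ne'
      simp only [srwP_eq_s13, ← sum_div, sum_edgeWeight]
      exact div_self this)
    hH.diag hH.nonneg (fun x y => hH.eq_one_add_sum_srwP (hdpos x)) T hroute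
    (W := ∅) (by rw [empty_union, univ_subset_iff.1 hS])
  simp only [coverSurvFrom_empty] at hcov
  refine hcov.trans (hc.trans ?_)
  gcongr
  norm_num
end

section
/- Let G be a connected undirected graph on n vertices in which every vertex has at least d distinct neighbours, and let A ⊆ V with |A| < n. Then for every vertex v, the graph distance from v to the complement of A satisfies d(v, A^c) ≤ 3|A|/d + 1. -/
open Finset

/-- In a connected graph, every value up to `G.dist v w` is attained as a distance from `v`. -/
theorem SimpleGraph.Connected.exists_dist_eq {V : Type*} {G : SimpleGraph V}
    (hconn : G.Connected) (v w : V) {i : ℕ} (hi : i ≤ G.dist v w) :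
    ∃ u, G.dist v u = i := by
  obtain ⟨p, hp⟩ := hconn.exists_walk_length_eq_dist v w
  refine ⟨p.getVert i, ?_⟩
  have htake := SimpleGraph.dist_le (p.take i)
  have hdrop := SimpleGraph.dist_le (p.drop i)
  have htri := hconn.dist_triangle (u := v) (v := p.getVert i) (w := w)
  rw [SimpleGraph.Walk.take_length] at htake
  rw [SimpleGraph.Walk.drop_length] at hdrop
  omega

/-- If `A` contains the ball of radius `k - 1` around `v` and some vertex is at distance `k`
from `v`, then the neighbourhoods of `(k + 1) / 3` vertices pairwise at distance at least `3`
fit disjointly into `A`. -/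
theorem SimpleGraph.Connected.div_three_mul_le_card {V : Type*} [Fintype V] [DecidableEq V]
    {G : SimpleGraph V} [DecidableRel G.Adj] (hconn : G.Connected) {d : ℕ}
    (hdeg : ∀ v : V, d ≤ G.degree v) {A : Finset V} {v w : V}
    (hball : ∀ u, G.dist v u < G.dist v w → u ∈ A) :
    (G.dist v w + 1) / 3 * d ≤ A.card := by
  have : Nonempty V := ⟨v⟩
  choose! p hp using fun i (hi : i ≤ G.dist v w) => hconn.exists_dist_eq v w hi
  have hnear : ∀ j ∈ range ((G.dist v w + 1) / 3), ∀ u ∈ G.neighborFinset (p (3 * j)),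
      G.dist v u ≤ 3 * j + 1 ∧ 3 * j ≤ G.dist v u + 1 := by
    intro j hj u hu
    rw [mem_range] at hj
    rw [SimpleGraph.mem_neighborFinset] at hu
    have hpj := hp (3 * j) (by omega)
    have hout := hconn.dist_triangle (u := v) (v := p (3 * j)) (w := u)
    have hback := hconn.dist_triangle (u := v) (v := u) (w := p (3 * j))
    rw [SimpleGraph.dist_eq_one_iff_adj.mpr hu] at hout
    rw [SimpleGraph.dist_eq_one_iff_adj.mpr hu.symm] at hback
    omega
  have hdisj : ((range ((G.dist v w + 1) / 3) : Finset ℕ) : Set ℕ).PairwiseDisjoint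
      fun j => G.neighborFinset (p (3 * j)) := by
    intro i hi j hj hij
    refine Finset.disjoint_left.mpr fun u hui huj => hij ?_
    have hnear_i := hnear i hi u hui
    have hnear_j := hnear j hj u huj
    omega
  have hsub : (range ((G.dist v w + 1) / 3)).biUnion
      (fun j => G.neighborFinset (p (3 * j))) ⊆ A := by
    refine biUnion_subset.mpr fun j hj u hu => hball u ?_
    have hnear_j := hnear j hj u hu
    rw [mem_range] at hj
    omega
  calc (G.dist v w + 1) / 3 * d
      = ∑ _j ∈ range ((G.dist v w + 1) / 3), d := by simp
    _ ≤ ∑ j ∈ range ((G.dist v w + 1) / 3), (G.neighborFinset (p (3 * j))).card :=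
        sum_le_sum fun j _ => by simpa using hdeg (p (3 * j))
    _ = _ := (card_biUnion hdisj).symm
    _ ≤ A.card := card_le_card hsub

/-- Let `G` be a connected undirected graph on `n` vertices in which every
vertex has at least `d` distinct neighbours, and let `A ⊆ V` with `|A| < n`. Then for every
vertex `v`, the graph distance from `v` to the complement of `A` satisfies
`d(v, Aᶜ) ≤ 3|A|/d + 1`, i.e. there is `w ∉ A` with `d(v,w) ≤ 3|A|/d + 1`. -/
theorem dist_to_complement_le
    (V : Type) [Fintype V] [DecidableEq V] (G : SimpleGraph V) [DecidableRel G.Adj]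
    (hconn : G.Connected) (d : ℕ) (hd : 0 < d)
    (hdeg : ∀ v : V, d ≤ G.degree v)
    (A : Finset V) (hA : A.card < Fintype.card V) (v : V) :
    ∃ w : V, w ∉ A ∧ (G.dist v w : ℝ) ≤ 3 * (A.card : ℝ) / (d : ℝ) + 1 := by
  have hne : Aᶜ.Nonempty := by
    rw [← card_pos, card_compl]
    omega
  obtain ⟨w, hw, hmin⟩ := exists_min_image Aᶜ (G.dist v) hne
  refine ⟨w, mem_compl.mp hw, ?_⟩
  have hcard := hconn.div_three_mul_le_card hdeg (A := A) (v := v) (w := w) fun u hu => by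
    by_contra huA
    exact absurd (hmin u (mem_compl.mpr huA)) (not_le.mpr hu)
  have hdiv : G.dist v w ≤ 3 * ((G.dist v w + 1) / 3) + 1 := by omega
  generalize (G.dist v w + 1) / 3 = m at hcard hdiv
  have hm : (3 * m : ℝ) ≤ 3 * A.card / d := by
    rw [le_div_iff₀ (by exact_mod_cast hd), mul_assoc]
    exact_mod_cast Nat.mul_le_mul_left 3 hcard
  calc (G.dist v w : ℝ) ≤ 3 * m + 1 := by exact_mod_cast hdiv
    _ ≤ _ := by gcongr
end
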